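/- arXiv:1809.02912 — 14 statements merged into one kernel-verified Lean document; each statement's English description precedes it below -/
import Mathlib

section
/- Let F>0, H_R>0 and ν>1, and set H_L=ν²H_R, Q_L=H_L^{3/2}, Q_R=H_R^{3/2}, c=((ν²+ν+1)/(ν+1))·√H_R, q₀=(ν²/(ν+1))·H_R^{3/2}, and H_*=((−(ν+1)+√(8F²ν⁴+ν²+2ν+1))/(2(ν+1)))·H_R. Then c>0, q₀>0, H_*>0, Q_L−c·H_L=−q₀, Q_R−c·H_R=−q₀, and q₀²/H_*+H_*²/(2F²)=q₀²/H_R+H_R²/(2F²). -/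
/-- Explicit solution of the equilibrium and Rankine–Hugoniot relations for hydraulic
shock profiles of the Saint-Venant equations. -/
theorem stmt_0 (F H_R ν : ℝ) (hF : 0 < F) (hHR : 0 < H_R) (hν : 1 < ν)
    (H_L Q_L Q_R c q₀ H_star : ℝ)
    (hHL : H_L = ν ^ 2 * H_R)
    (hQL : Q_L = H_L ^ ((3:ℝ)/2))
    (hQR : Q_R = H_R ^ ((3:ℝ)/2))
    (hc : c = ((ν ^ 2 + ν + 1) / (ν + 1)) * Real.sqrt H_R)
    (hq0 : q₀ = (ν ^ 2 / (ν + 1)) * H_R ^ ((3:ℝ)/2))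
    (hHstar : H_star = ((-(ν + 1) + Real.sqrt (8 * F ^ 2 * ν ^ 4 + ν ^ 2 + 2 * ν + 1)) /
      (2 * (ν + 1))) * H_R) :
    0 < c ∧ 0 < q₀ ∧ 0 < H_star ∧
      Q_L - c * H_L = -q₀ ∧ Q_R - c * H_R = -q₀ ∧
      q₀ ^ 2 / H_star + H_star ^ 2 / (2 * F ^ 2) = q₀ ^ 2 / H_R + H_R ^ 2 / (2 * F ^ 2) := by
  have key : ∀ x : ℝ, 0 < x → (x ^ 2) ^ ((3:ℝ)/2) = x ^ 3 := by
    intro x hx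
    rw [← Real.rpow_natCast x 2, ← Real.rpow_mul hx.le, ← Real.rpow_natCast x 3]
    norm_num
  obtain ⟨s, hs, rfl⟩ : ∃ s : ℝ, 0 < s ∧ H_R = s ^ 2 :=
    ⟨Real.sqrt H_R, Real.sqrt_pos.mpr hHR, (Real.sq_sqrt hHR.le).symm⟩
  have hν0 : 0 < ν := by linarith
  have hν1 : 0 < ν + 1 := by linarith
  rw [← mul_pow] at hHL
  rw [hHL, key _ (mul_pos hν0 hs)] at hQL
  rw [key s hs] at hQR hq0
  rw [Real.sqrt_sq hs.le] at hc
  have hFν : 0 < 8 * F ^ 2 * ν ^ 4 := by positivity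
  have hS2 : Real.sqrt (8 * F ^ 2 * ν ^ 4 + ν ^ 2 + 2 * ν + 1) ^ 2
      = 8 * F ^ 2 * ν ^ 4 + ν ^ 2 + 2 * ν + 1 := Real.sq_sqrt (by positivity)
  have hS : ν + 1 < Real.sqrt (8 * F ^ 2 * ν ^ 4 + ν ^ 2 + 2 * ν + 1) :=
    Real.lt_sqrt_of_sq_lt (by nlinarith)
  generalize Real.sqrt (8 * F ^ 2 * ν ^ 4 + ν ^ 2 + 2 * ν + 1) = S at *
  have hstar : 0 < H_star := by
    rw [hHstar]
    have : 0 < -(ν + 1) + S := by linarith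
    positivity
  have hjump : q₀ ^ 2 * (2 * F ^ 2) = H_star * s ^ 2 * (s ^ 2 + H_star) := by
    rw [hq0, hHstar]
    field_simp
    linear_combination (-1) * hS2
  refine ⟨by rw [hc]; positivity, by rw [hq0]; positivity, hstar, ?_, ?_, ?_⟩
  · rw [hQL, hc, hHL, hq0]
    field_simp
    ring
  · rw [hQR, hc, hq0]
    field_simp
    ring
  · clear hq0 hHstar
    have hs2 : s ^ 2 ≠ 0 := hHR.ne'
    generalize s ^ 2 = h at *
    have hsn := hstar.ne'
    rw [div_add_div _ _ hsn (by positivity), div_add_div _ _ hs2 (by positivity),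
      div_eq_div_iff (by positivity) (by positivity)]
    linear_combination (2 * F ^ 2) * (h - H_star) * hjump
end

section
/- Let F>0, H_R>0, ν>1, H_L=ν²H_R and H_s=(Fν²/(ν+1))^{2/3}·H_R. Then the following are equivalent: (a) H_s>H_R; (b) Fν²−ν−1>0; (c) H_L > H_R·(1+2F+√(1+4F))/(2F²). Moreover, if F>2 then these conditions hold. -/
/-- Criterion for the sonic point to lie above the right endstate (subshock criterion). -/
theorem stmt_2 (F H_R ν : ℝ) (hF : 0 < F) (hHR : 0 < H_R) (hν : 1 < ν)
    (H_L H_s : ℝ)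
    (hHL : H_L = ν ^ 2 * H_R)
    (hHs : H_s = (F * ν ^ 2 / (ν + 1)) ^ ((2:ℝ)/3) * H_R) :
    ((H_R < H_s ↔ 0 < F * ν ^ 2 - ν - 1) ∧
     (H_R < H_s ↔ H_R * (1 + 2 * F + Real.sqrt (1 + 4 * F)) / (2 * F ^ 2) < H_L)) ∧
    (2 < F → H_R < H_s) := by
  have hν1 : 0 < ν + 1 := by linarith
  have hq : 0 ≤ F * ν ^ 2 / (ν + 1) := by positivity
  have hab : H_R < H_s ↔ 0 < F * ν ^ 2 - ν - 1 := by
    have h1 : H_R < H_s ↔ 1 < (F * ν ^ 2 / (ν + 1)) ^ ((2:ℝ)/3) := by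
      rw [hHs]
      exact lt_mul_iff_one_lt_left hHR
    have h2 : 1 < (F * ν ^ 2 / (ν + 1)) ^ ((2:ℝ)/3) ↔ 1 < F * ν ^ 2 / (ν + 1) := by
      have := Real.rpow_lt_rpow_iff (x := 1) (y := F * ν ^ 2 / (ν + 1)) (z := (2:ℝ)/3)
        zero_le_one hq (by norm_num)
      rwa [Real.one_rpow] at this
    rw [h1, h2, one_lt_div hν1]
    constructor <;> intro h <;> linarith
  refine ⟨⟨hab, ?_⟩, ?_⟩
  · rw [hab]
    set s := Real.sqrt (1 + 4 * F) with hs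
    have hs2 : s ^ 2 = 1 + 4 * F := Real.sq_sqrt (by linarith)
    have hs0 : 0 ≤ s := Real.sqrt_nonneg _
    have hs1 : 1 < s := by nlinarith
    have hFν : 0 < F * ν := by positivity
    have key : 0 < F * ν ^ 2 - ν - 1 ↔ 1 + s < 2 * F * ν := by
      have e : 4 * F * (F * ν ^ 2 - ν - 1) = (2 * F * ν - 1 - s) * (2 * F * ν - 1 + s) := by
        linear_combination hs2
      have hpos : 0 < 2 * F * ν - 1 + s := by linarith
      rw [← mul_pos_iff_of_pos_left (show 0 < 4 * F by linarith), e,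
        mul_pos_iff_of_pos_right hpos]
      constructor <;> intro h <;> linarith
    have hc : H_R * (1 + 2 * F + s) / (2 * F ^ 2) < H_L ↔ (1 + s) ^ 2 < (2 * F * ν) ^ 2 := by
      rw [hHL, div_lt_iff₀ (by positivity),
        show ν ^ 2 * H_R * (2 * F ^ 2) = H_R * (ν ^ 2 * (2 * F ^ 2)) by ring,
        mul_lt_mul_iff_right₀ hHR]
      constructor <;> intro h <;> nlinarith
    rw [key, hc, sq_lt_sq₀ (by linarith) (by linarith)]
  · intro h
    rw [hab]
    nlinarith [mul_pos (sub_pos.2 h) (pow_pos (show 0 < ν by linarith) 2)]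
end

section
/- Let F>0, H_R>0, ν>1, H_L=ν²H_R, H_s=(Fν²/(ν+1))^{2/3}·H_R, and H_*=((−(ν+1)+√(8F²ν⁴+ν²+2ν+1))/(2(ν+1)))·H_R. Then the following are equivalent: (a) H_s<H_L; (b) F<ν²+ν; (c) H_L > H_R·(1+2F−√(1+4F))/2. Moreover, if 0<F<2 then these conditions hold, and in addition H_*<H_L. -/
/-- Criterion for the sonic point to lie below the left endstate; in the regime 0<F<2
these conditions hold, and moreover H_* < H_L. -/
theorem stmt_3 (F H_R ν : ℝ) (hF : 0 < F) (hHR : 0 < H_R) (hν : 1 < ν)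
    (H_L H_s H_star : ℝ)
    (hHL : H_L = ν ^ 2 * H_R)
    (hHs : H_s = (F * ν ^ 2 / (ν + 1)) ^ ((2:ℝ)/3) * H_R)
    (hHstar : H_star = ((-(ν + 1) + Real.sqrt (8 * F ^ 2 * ν ^ 4 + ν ^ 2 + 2 * ν + 1)) /
      (2 * (ν + 1))) * H_R) :
    ((H_s < H_L ↔ F < ν ^ 2 + ν) ∧
     (H_s < H_L ↔ H_R * (1 + 2 * F - Real.sqrt (1 + 4 * F)) / 2 < H_L)) ∧
    (F < 2 → H_s < H_L ∧ H_star < H_L) := by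
  have hν0 : 0 < ν := by linarith
  have h1 : H_s < H_L ↔ F < ν ^ 2 + ν := by
    have e : ν ^ 2 = (ν ^ 3) ^ ((2:ℝ)/3) := by
      rw [← Real.rpow_natCast ν 3, ← Real.rpow_mul hν0.le, ← Real.rpow_natCast ν 2]
      norm_num
    have e2 : H_L = (ν ^ 3) ^ ((2:ℝ)/3) * H_R := by rw [hHL, ← e]
    rw [hHs, e2, mul_lt_mul_iff_left₀ hHR,
      Real.rpow_lt_rpow_iff (by positivity) (by positivity) (by norm_num),
      div_lt_iff₀ (by linarith)]
    have e3 : ν ^ 3 * (ν + 1) = (ν ^ 2 + ν) * ν ^ 2 := by ring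
    rw [e3, mul_lt_mul_iff_left₀ (by positivity)]
  have h2 : H_R * (1 + 2 * F - Real.sqrt (1 + 4 * F)) / 2 < H_L ↔ F < ν ^ 2 + ν := by
    have hs : Real.sqrt (1 + 4 * F) ^ 2 = 1 + 4 * F := Real.sq_sqrt (by linarith)
    have hs1 : 1 < Real.sqrt (1 + 4 * F) := by
      rw [Real.lt_sqrt (by norm_num)]; linarith
    have e : H_R * (1 + 2 * F - Real.sqrt (1 + 4 * F)) / 2
        = ((Real.sqrt (1 + 4 * F) - 1) / 2) ^ 2 * H_R := by
      linear_combination (-H_R / 4) * hs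
    rw [e, hHL, mul_lt_mul_iff_left₀ hHR,
      pow_lt_pow_iff_left₀ (by linarith) hν0.le (by norm_num)]
    constructor
    · intro h
      nlinarith
    · intro h
      by_contra! h'
      nlinarith
  refine ⟨⟨h1, h1.trans h2.symm⟩, fun hF2 => ⟨h1.2 (by nlinarith), ?_⟩⟩
  rw [hHstar, hHL, mul_lt_mul_iff_left₀ hHR, div_lt_iff₀ (by linarith)]
  have key : Real.sqrt (8 * F ^ 2 * ν ^ 4 + ν ^ 2 + 2 * ν + 1) < (ν + 1) * (2 * ν ^ 2 + 1) := by
    rw [Real.sqrt_lt' (by positivity)]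
    have hF4 : F ^ 2 < 4 := by nlinarith
    have a : 8 * ν ^ 2 ≤ (ν + 1) ^ 2 * (ν ^ 2 + 1) := by
      have b1 : 4 * ν ≤ (ν + 1) ^ 2 := by nlinarith [sq_nonneg (ν - 1)]
      have b2 : 2 * ν ≤ ν ^ 2 + 1 := by nlinarith [sq_nonneg (ν - 1)]
      have := mul_le_mul b1 b2 (by positivity) (by positivity)
      linarith
    have c : 2 * F ^ 2 * ν ^ 2 < (ν + 1) ^ 2 * (ν ^ 2 + 1) := by
      have : 0 < ν ^ 2 := by positivity
      nlinarith
    have d := mul_lt_mul_of_pos_left c (show 0 < 4 * ν ^ 2 by positivity)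
    linarith
  linarith
end

section
/- Let 0<F<2, H_R>0 and ν>1 with Fν²<ν+1. With the profile parameters H_L=ν²H_R, H₃=(ν²/(ν+1)²)·H_R, H_s=(Fν²/(ν+1))^{2/3}·H_R and G(H)=F²(H−H_L)(H−H_R)(H−H₃)/((H−H_s)(H²+H·H_s+H_s²)), one has H_s<H_R<H_L, and there exists a differentiable, strictly decreasing function H:ℝ→ℝ with H(x)∈(H_R,H_L) for all x, satisfying H'(x)=G(H(x)) for every x∈ℝ, with H(x)→H_L as x→−∞ and H(x)→H_R as x→+∞. -/
open Filter

theorem profile_aux (a b : ℝ) (hab : a < b) (T g : ℝ → ℝ)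
    (hT : ∀ h ∈ Set.Ioo a b, HasDerivAt T (g h)⁻¹ h)
    (hg : ∀ h ∈ Set.Ioo a b, g h < 0)
    (hTa : Tendsto T (nhdsWithin a (Set.Ioi a)) atTop)
    (hTb : Tendsto T (nhdsWithin b (Set.Iio b)) atBot) :
    ∃ H : ℝ → ℝ, Differentiable ℝ H ∧ StrictAnti H ∧
      (∀ x, H x ∈ Set.Ioo a b) ∧
      (∀ x, deriv H x = g (H x)) ∧
      Tendsto H atBot (nhds b) ∧
      Tendsto H atTop (nhds a) := by
  have hcont : ContinuousOn T (Set.Ioo a b) := fun h hh =>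
    (hT h hh).continuousAt.continuousWithinAt
  have hanti : StrictAntiOn T (Set.Ioo a b) := by
    apply strictAntiOn_of_deriv_neg (convex_Ioo a b) hcont
    intro x hx
    rw [interior_Ioo] at hx
    rw [(hT x hx).deriv]
    exact inv_lt_zero.2 (hg x hx)
  have hsurj : ∀ x : ℝ, ∃ h ∈ Set.Ioo a b, T h = x := by
    intro x
    obtain ⟨p, hp1, hp2⟩ := ((hTa.eventually (eventually_ge_atTop x)).and
      (Ioo_mem_nhdsGT hab)).exists
    obtain ⟨q, hq1, hq2⟩ := ((hTb.eventually (eventually_le_atBot x)).and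
      (Ioo_mem_nhdsLT hab)).exists
    exact isPreconnected_Ioo.intermediate_value hq2 hp2 hcont ⟨hq1, hp1⟩
  choose H hmem hTH using hsurj
  have hHT : ∀ h ∈ Set.Ioo a b, H (T h) = h := fun h hh =>
    hanti.injOn (hmem _) hh (hTH _)
  have hlt : ∀ x, ∀ p ∈ Set.Ioo a b, T p < x → H x < p := by
    intro x p hp hx
    rw [← hTH x] at hx
    exact (hanti.lt_iff_gt hp (hmem x)).1 hx
  have hgt : ∀ x, ∀ p ∈ Set.Ioo a b, x < T p → p < H x := by
    intro x p hp hx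
    rw [← hTH x] at hx
    exact (hanti.lt_iff_gt (hmem x) hp).1 hx
  have hH : StrictAnti H := by
    intro x y hxy
    exact hlt y (H x) (hmem x) (by rw [hTH]; exact hxy)
  have hcH : ∀ x, ContinuousAt H x := by
    intro x
    refine tendsto_order.2 ⟨fun c hc => ?_, fun c hc => ?_⟩
    · obtain ⟨p, hp1, hp2⟩ := exists_between (max_lt hc (hmem x).1)
      have hp : p ∈ Set.Ioo a b :=
        ⟨(le_max_right _ _).trans_lt hp1, hp2.trans (hmem x).2⟩
      have : x < T p := by
        have := hanti hp (hmem x) hp2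
        rwa [hTH] at this
      filter_upwards [eventually_lt_nhds this] with y hy
      exact ((le_max_left _ _).trans_lt hp1).trans (hgt y p hp hy)
    · obtain ⟨p, hp1, hp2⟩ := exists_between (lt_min hc (hmem x).2)
      have hp : p ∈ Set.Ioo a b :=
        ⟨(hmem x).1.trans hp1, hp2.trans_le (min_le_right _ _)⟩
      have : T p < x := by
        have := hanti (hmem x) hp hp1
        rwa [hTH] at this
      filter_upwards [eventually_gt_nhds this] with y hy
      exact (hlt y p hp hy).trans (hp2.trans_le (min_le_left _ _))
  have hder : ∀ x, HasDerivAt H (g (H x)) x := by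
    intro x
    have := HasDerivAt.of_local_left_inverse (hcH x) (hT (H x) (hmem x))
      (inv_ne_zero (hg _ (hmem x)).ne) (Eventually.of_forall hTH)
    rwa [inv_inv] at this
  refine ⟨H, fun x => (hder x).differentiableAt, hH, hmem, fun x => (hder x).deriv, ?_, ?_⟩
  · refine tendsto_order.2 ⟨fun c hc => ?_, fun c hc =>
      Eventually.of_forall fun x => (hmem x).2.trans hc⟩
    obtain ⟨p, hp1, hp2⟩ := exists_between (max_lt hc hab)
    have hp : p ∈ Set.Ioo a b := ⟨(le_max_right _ _).trans_lt hp1, hp2⟩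
    filter_upwards [eventually_lt_atBot (T p)] with y hy
    exact ((le_max_left _ _).trans_lt hp1).trans (hgt y p hp hy)
  · refine tendsto_order.2 ⟨fun c hc =>
      Eventually.of_forall fun x => hc.trans (hmem x).1, fun c hc => ?_⟩
    obtain ⟨p, hp1, hp2⟩ := exists_between (lt_min hc hab)
    have hp : p ∈ Set.Ioo a b := ⟨hp1, hp2.trans_le (min_le_right _ _)⟩
    filter_upwards [eventually_gt_atTop (T p)] with y hy
    exact (hlt y p hp hy).trans (hp2.trans_le (min_le_left _ _))

/-- Existence of a smooth heteroclinic hydraulic shock profile in the small-amplitude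
regime Fν² < ν+1. -/
theorem stmt_6 (F H_R ν : ℝ) (hF0 : 0 < F) (hF2 : F < 2) (hHR : 0 < H_R) (hν : 1 < ν)
    (hsmall : F * ν ^ 2 < ν + 1)
    (H_L H₃ H_s : ℝ)
    (hHL : H_L = ν ^ 2 * H_R)
    (hH3 : H₃ = (ν ^ 2 / (ν + 1) ^ 2) * H_R)
    (hHs : H_s = (F * ν ^ 2 / (ν + 1)) ^ ((2:ℝ)/3) * H_R)
    (G : ℝ → ℝ)
    (hG : ∀ H, G H = F ^ 2 * (H - H_L) * (H - H_R) * (H - H₃) /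
      ((H - H_s) * (H ^ 2 + H * H_s + H_s ^ 2))) :
    H_s < H_R ∧ H_R < H_L ∧
    ∃ H : ℝ → ℝ, Differentiable ℝ H ∧ StrictAnti H ∧
      (∀ x, H x ∈ Set.Ioo H_R H_L) ∧
      (∀ x, deriv H x = G (H x)) ∧
      Tendsto H atBot (nhds H_L) ∧
      Tendsto H atTop (nhds H_R) := by
  have hν1 : 0 < ν + 1 := by linarith
  have hbase0 : 0 < F * ν ^ 2 / (ν + 1) := by positivity
  have hs0 : 0 < H_s := by rw [hHs]; positivity
  have hsR : H_s < H_R := by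
    have h1 : (F * ν ^ 2 / (ν + 1)) ^ ((2:ℝ)/3) < 1 :=
      Real.rpow_lt_one hbase0.le ((div_lt_one hν1).2 hsmall) (by norm_num)
    rw [hHs]; nlinarith
  have hRL : H_R < H_L := by
    have h1 : 1 < ν ^ 2 := by nlinarith
    rw [hHL]; nlinarith
  have h3R : H₃ < H_R := by
    have h1 : ν ^ 2 / (ν + 1) ^ 2 < 1 := by
      rw [div_lt_one (by positivity)]; nlinarith
    rw [hH3]; nlinarith
  refine ⟨hsR, hRL, ?_⟩
  clear hHs hHL hH3 hsmall hbase0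
  have hcube : ∀ x, H_s < x → 0 < x ^ 3 - H_s ^ 3 := by
    intro x hx
    have : H_s ^ 3 < x ^ 3 := by gcongr
    linarith
  obtain ⟨A, hA⟩ : ∃ A, A = (H_L ^ 3 - H_s ^ 3) / ((H_L - H_R) * (H_L - H₃)) := ⟨_, rfl⟩
  obtain ⟨B, hB⟩ : ∃ B, B = (H_R ^ 3 - H_s ^ 3) / ((H_L - H_R) * (H_R - H₃)) := ⟨_, rfl⟩
  obtain ⟨C, hC⟩ : ∃ C, C = (H₃ ^ 3 - H_s ^ 3) / ((H_L - H₃) * (H_R - H₃)) := ⟨_, rfl⟩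
  have d1 : 0 < H_L - H_R := by linarith
  have d2 : 0 < H_L - H₃ := by linarith
  have d3 : 0 < H_R - H₃ := by linarith
  have hA0 : 0 < A := by
    rw [hA]; exact div_pos (hcube _ (hsR.trans hRL)) (by positivity)
  have hB0 : 0 < B := by
    rw [hB]; exact div_pos (hcube _ hsR) (by positivity)
  have hF2' : 0 < (F ^ 2)⁻¹ := by positivity
  refine profile_aux H_R H_L hRL (fun h => (F ^ 2)⁻¹ * (h + A * Real.log (H_L - h)
    - B * Real.log (h - H_R) + C * Real.log (h - H₃))) G ?_ ?_ ?_ ?_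
  · rintro h ⟨h1, h2⟩
    have e1 : 0 < H_L - h := by linarith
    have e2 : 0 < h - H_R := by linarith
    have e3 : 0 < h - H₃ := by linarith
    have := ((((hasDerivAt_id h).add ((((hasDerivAt_id h).const_sub H_L).log e1.ne').const_mul A)).sub
      ((((hasDerivAt_id h).sub_const H_R).log e2.ne').const_mul B)).add
      ((((hasDerivAt_id h).sub_const H₃).log e3.ne').const_mul C)).const_mul (F ^ 2)⁻¹
    refine this.congr_deriv ?_
    simp only [id]
    have e4 : h - H_L ≠ 0 := by linarith
    have : (h - H_s) * (h ^ 2 + h * H_s + H_s ^ 2) = h ^ 3 - H_s ^ 3 := by ring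
    rw [hG, this, inv_div, hA, hB, hC]
    rw [show H_L - h = -(h - H_L) by ring]
    field_simp
    ring
  · rintro h ⟨h1, h2⟩
    have e1 : 0 < H_L - h := by linarith
    have e2 : 0 < h - H_R := by linarith
    have e3 : 0 < h - H₃ := by linarith
    have : (h - H_s) * (h ^ 2 + h * H_s + H_s ^ 2) = h ^ 3 - H_s ^ 3 := by ring
    rw [hG, this]
    apply div_neg_of_neg_of_pos _ (hcube _ (hsR.trans h1))
    have : 0 < F ^ 2 * (H_L - h) * (h - H_R) * (h - H₃) := by positivity
    linarith
  · apply Tendsto.const_mul_atTop hF2'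
    have hlog : Tendsto (fun h => Real.log (h - H_R)) (nhdsWithin H_R (Set.Ioi H_R)) atBot := by
      apply Real.tendsto_log_nhdsGT_zero.comp
      apply tendsto_nhdsWithin_iff.2 ⟨?_, ?_⟩
      · have : ContinuousAt (fun h => h - H_R) H_R := by fun_prop
        simpa [ContinuousAt] using this.tendsto.mono_left nhdsWithin_le_nhds
      · filter_upwards [self_mem_nhdsWithin] with h hh
        simpa using hh
    have hc : ContinuousAt (fun h => h + A * Real.log (H_L - h) + C * Real.log (h - H₃)) H_R := by
      fun_prop (disch := linarith)
    refine Tendsto.congr ?_ ((hc.tendsto.mono_left nhdsWithin_le_nhds).add_atTop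
      (hlog.const_mul_atBot_of_neg (neg_lt_zero.2 hB0)))
    intro h; ring
  · apply Tendsto.const_mul_atBot hF2'
    have hlog : Tendsto (fun h => Real.log (H_L - h)) (nhdsWithin H_L (Set.Iio H_L)) atBot := by
      apply Real.tendsto_log_nhdsGT_zero.comp
      apply tendsto_nhdsWithin_iff.2 ⟨?_, ?_⟩
      · have : ContinuousAt (fun h => H_L - h) H_L := by fun_prop
        simpa [ContinuousAt] using this.tendsto.mono_left nhdsWithin_le_nhds
      · filter_upwards [self_mem_nhdsWithin] with h hh
        simpa using hh
    have hc : ContinuousAt (fun h => h - B * Real.log (h - H_R) + C * Real.log (h - H₃)) H_L := by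
      fun_prop (disch := linarith)
    refine Tendsto.congr ?_ ((hc.tendsto.mono_left nhdsWithin_le_nhds).add_atBot
      (hlog.const_mul_atBot hA0))
    intro h; ring
end

section
/- Let 0<F<2, H_R>0 and ν>1 with Fν²>ν+1. With the profile parameters q₀=(ν²/(ν+1))·H_R^{3/2}, H_L=ν²H_R, H₃=(ν²/(ν+1)²)·H_R, H_s=(Fν²/(ν+1))^{2/3}·H_R, H_*=((−(ν+1)+√(8F²ν⁴+ν²+2ν+1))/(2(ν+1)))·H_R and G(H)=F²(H−H_L)(H−H_R)(H−H₃)/((H−H_s)(H²+H·H_s+H_s²)), one has H_R<H_s<H_*<H_L, and there exists a function H:ℝ→ℝ, differentiable and strictly decreasing on (−∞,0], with H(0)=H_*, H(x)∈(H_*,H_L) for all x<0, H'(x)=G(H(x)) for all x≤0, and H(x)→H_L as x→−∞. Moreover the Lax 2-shock conditions hold: −q₀/H_*−√H_*/F < 0 < −q₀/H_*+√H_*/F, and −q₀/H_R+√H_R/F < 0. -/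
open Filter

/-- A scalar autonomous ODE solved by inverting a time function. -/
lemma ode_inverse (T g : ℝ → ℝ) (c p L : ℝ) (hcp : c < p) (hpL : p < L)
    (hT : ∀ h, c ≤ h → h < L → HasDerivAt T (1 / g h) h)
    (hg : ∀ h, c ≤ h → h < L → g h < 0) (hp : T p = 0)
    (hlim : Tendsto T (nhdsWithin L (Set.Iio L)) atBot) :
    ∃ H : ℝ → ℝ, StrictAntiOn H (Set.Iic 0) ∧ H 0 = p ∧
      (∀ x < (0:ℝ), H x ∈ Set.Ioo p L) ∧
      (∀ x ≤ (0:ℝ), HasDerivAt H (g (H x)) x) ∧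
      Tendsto H atBot (nhds L) := by
  classical
  have hcL := hcp.trans hpL
  have hcont : ContinuousOn T (Set.Ico c L) := fun h hh =>
    (hT h hh.1 hh.2).continuousAt.continuousWithinAt
  have hanti : StrictAntiOn T (Set.Ico c L) := by
    apply strictAntiOn_of_deriv_neg (convex_Ico c L) hcont
    intro h hh
    rw [interior_Ico] at hh
    rw [(hT h hh.1.le hh.2).deriv]
    exact one_div_neg.2 (hg h hh.1.le hh.2)
  have hd : 0 < T c := by
    rw [← hp]; exact hanti ⟨le_rfl, hcL⟩ ⟨hcp.le, hpL⟩ hcp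
  have hsurj : ∀ x, x < T c → ∃ h, c < h ∧ h < L ∧ T h = x := by
    intro x hx
    have h1 : ∀ᶠ h in nhdsWithin L (Set.Iio L), T h < x := hlim.eventually_lt_atBot x
    have h2 : ∀ᶠ h in nhdsWithin L (Set.Iio L), h ∈ Set.Ioo c L := Ioo_mem_nhdsLT hcL
    obtain ⟨b, hb1, hb2⟩ := (h1.and h2).exists
    have hc' : ContinuousOn T (Set.Icc c b) :=
      hcont.mono fun y hy => ⟨hy.1, hy.2.trans_lt hb2.2⟩
    obtain ⟨h, hh, e⟩ := intermediate_value_Ioo' hb2.1.le hc' ⟨hb1, hx⟩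
    exact ⟨h, hh.1, hh.2.trans hb2.2, e⟩
  let H : ℝ → ℝ := fun x => if hx : x < T c then (hsurj x hx).choose else 0
  have hH : ∀ x, x < T c → c < H x ∧ H x < L ∧ T (H x) = x := by
    intro x hx
    simp only [H, dif_pos hx]
    exact (hsurj x hx).choose_spec
  have hlow : ∀ x a, x < T c → c < a → a < L → x < T a → a < H x := by
    intro x a hx h1 h2 h3
    by_contra hcon
    obtain ⟨u, v, w⟩ := hH x hx
    have := hanti.antitoneOn ⟨u.le, v⟩ ⟨h1.le, h2⟩ (not_lt.1 hcon)
    linarith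
  have hup : ∀ x a, x < T c → c < a → a < L → T a < x → H x < a := by
    intro x a hx h1 h2 h3
    by_contra hcon
    obtain ⟨u, v, w⟩ := hH x hx
    have := hanti.antitoneOn ⟨h1.le, h2⟩ ⟨u.le, v⟩ (not_lt.1 hcon)
    linarith
  have hHc : ∀ x, x < T c → ContinuousAt H x := by
    intro x hx
    obtain ⟨u, v, w⟩ := hH x hx
    refine tendsto_order.2 ⟨fun a ha => ?_, fun b hb => ?_⟩
    · obtain ⟨a', h1, h2⟩ := exists_between (max_lt ha u)
      have hc1 : c < a' := (le_max_right _ _).trans_lt h1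
      have : x < T a' := by
        rw [← w]; exact hanti ⟨hc1.le, h2.trans v⟩ ⟨u.le, v⟩ h2
      filter_upwards [Iio_mem_nhds hx, Iio_mem_nhds this] with y hy hy'
      exact ((le_max_left _ _).trans_lt h1).trans (hlow y a' hy hc1 (h2.trans v) hy')
    · obtain ⟨b', h1, h2⟩ := exists_between (lt_min hb v)
      have hc1 : b' < L := h2.trans_le (min_le_right _ _)
      have : T b' < x := by
        rw [← w]; exact hanti ⟨u.le, v⟩ ⟨(u.trans h1).le, hc1⟩ h1
      filter_upwards [Iio_mem_nhds hx, Ioi_mem_nhds this] with y hy hy'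
      exact (hup y b' hy (u.trans h1) hc1 hy').trans (h2.trans_le (min_le_left _ _))
  have h0 : H 0 = p := by
    obtain ⟨u, v, w⟩ := hH 0 hd
    exact hanti.injOn ⟨u.le, v⟩ ⟨hcp.le, hpL⟩ (w.trans hp.symm)
  refine ⟨H, ?_, h0, ?_, ?_, ?_⟩
  · intro x hx y hy hxy
    have hx' : x < T c := lt_of_le_of_lt hx hd
    obtain ⟨u, v, w⟩ := hH y (lt_of_le_of_lt hy hd)
    exact hlow x _ hx' u v (by rw [w]; exact hxy)
  · intro x hx
    exact ⟨hlow x p (hx.trans hd) hcp hpL (by rw [hp]; exact hx), (hH x (hx.trans hd)).2.1⟩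
  · intro x hx
    have hx' : x < T c := lt_of_le_of_lt hx hd
    obtain ⟨u, v, w⟩ := hH x hx'
    have := HasDerivAt.of_local_left_inverse (hHc x hx') (hT _ u.le v)
      (one_div_neg.2 (hg _ u.le v)).ne
      (by filter_upwards [Iio_mem_nhds hx'] with y hy using (hH y hy).2.2)
    simpa using this
  · refine tendsto_order.2 ⟨fun a ha => ?_, fun b hb => ?_⟩
    · obtain ⟨a', h1, h2⟩ := exists_between (max_lt ha hcL)
      have hc1 : c < a' := (le_max_right _ _).trans_lt h1
      filter_upwards [Iio_mem_atBot (T c), Iio_mem_atBot (T a')] with y hy hy'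
      exact ((le_max_left _ _).trans_lt h1).trans (hlow y a' hy hc1 h2 hy')
    · filter_upwards [Iio_mem_atBot (T c)] with y hy
      exact (hH y hy).2.1.trans hb

/-- The profile ODE, solved with an explicit partial fraction time function. -/
lemma profile_exists (F D R s p L : ℝ) (hF : 0 < F) (hD : 0 < D) (hDR : D < R) (hRs : R < s)
    (hsp : s < p) (hpL : p < L) (G : ℝ → ℝ)
    (hG : ∀ H, G H = F ^ 2 * (H - L) * (H - R) * (H - D) /
      ((H - s) * (H ^ 2 + H * s + s ^ 2))) :
    ∃ H : ℝ → ℝ, StrictAntiOn H (Set.Iic 0) ∧ H 0 = p ∧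
      (∀ x < (0:ℝ), H x ∈ Set.Ioo p L) ∧
      (∀ x ≤ (0:ℝ), HasDerivAt H (G (H x)) x) ∧
      Tendsto H atBot (nhds L) := by
  obtain ⟨c, hc1, hc2⟩ := exists_between hsp
  set A := (L ^ 3 - s ^ 3) / ((L - R) * (L - D)) with hA
  set B := (R ^ 3 - s ^ 3) / ((R - L) * (R - D)) with hB
  set C := (D ^ 3 - s ^ 3) / ((D - L) * (D - R)) with hC
  have hApos : 0 < A := by
    apply div_pos
    · have : s ^ 3 < L ^ 3 := by
        apply pow_lt_pow_left₀ <;> linarith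
      linarith
    · apply mul_pos <;> linarith
  let S : ℝ → ℝ := fun h =>
    (h + A * Real.log (h - L) + B * Real.log (h - R) + C * Real.log (h - D)) / F ^ 2
  have hSd : ∀ h, c ≤ h → h < L → HasDerivAt S (1 / G h) h := by
    intro h h1 h2
    have eL : h - L ≠ 0 := by linarith
    have eR : h - R ≠ 0 := by linarith
    have eD : h - D ≠ 0 := by linarith
    have := ((((hasDerivAt_id h).add ((((hasDerivAt_id h).sub_const L).log eL).const_mul A)).add
      ((((hasDerivAt_id h).sub_const R).log eR).const_mul B)).add
      ((((hasDerivAt_id h).sub_const D).log eD).const_mul C)).div_const (F ^ 2)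
    refine this.congr_deriv ?_
    rw [hG, one_div_div, hA, hB, hC]
    have e1 : L - R ≠ 0 := by linarith
    have e2 : L - D ≠ 0 := by linarith
    have e3 : R - D ≠ 0 := by linarith
    have e4 : R - L ≠ 0 := by linarith
    have e5 : D - L ≠ 0 := by linarith
    have e6 : D - R ≠ 0 := by linarith
    rw [show R - L = -(L - R) by ring, show D - L = -(L - D) by ring,
      show D - R = -(R - D) by ring]
    simp only [id]
    field_simp
    ring
  have hlim : Tendsto S (nhdsWithin L (Set.Iio L)) atBot := by
    have h1 : Tendsto (fun h : ℝ => h - L) (nhdsWithin L (Set.Iio L))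
        (nhdsWithin 0 {0}ᶜ) := by
      apply tendsto_nhdsWithin_iff.2 ⟨?_, ?_⟩
      · have : ContinuousAt (fun h : ℝ => h - L) L := by fun_prop
        simpa using this.tendsto.mono_left nhdsWithin_le_nhds
      · filter_upwards [self_mem_nhdsWithin] with h hh
        simp only [Set.mem_Iio] at hh
        simp; linarith
    have h2 := (Real.tendsto_log_nhdsNE_zero.comp h1).const_mul_atBot hApos
    have h3 : ContinuousAt (fun h => h + B * Real.log (h - R) + C * Real.log (h - D)) L := by
      have eR : L - R ≠ 0 := by linarith
      have eD : L - D ≠ 0 := by linarith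
      fun_prop (disch := assumption)
    have h4 := (h2.atBot_add (h3.tendsto.mono_left nhdsWithin_le_nhds)).atBot_div_const
      (show 0 < F ^ 2 by positivity)
    refine h4.congr fun h => ?_
    simp only [S, Function.comp]
    ring
  apply ode_inverse (fun h => S h - S p) G c p L hc2 hpL
  · intro h h1 h2
    exact (hSd h h1 h2).sub_const _
  · intro h h1 h2
    rw [hG]
    apply div_neg_of_neg_of_pos
    · have a1 : 0 < F ^ 2 := by positivity
      have a2 : 0 < h - R := by linarith
      have a3 : 0 < h - D := by linarith
      have a4 : h - L < 0 := by linarith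
      exact mul_neg_of_neg_of_pos (mul_neg_of_neg_of_pos (mul_neg_of_pos_of_neg a1 a4) a2) a3
    · have : 0 < h := by linarith
      have : 0 < s := by linarith
      apply mul_pos
      · linarith
      · positivity
  · simp
  · simpa [sub_eq_add_neg] using hlim.atBot_add (tendsto_const_nhds (x := - S p))



set_option maxHeartbeats 2000000 in
/-- Existence of a discontinuous hydraulic shock profile (smooth piece plus Lax 2-subshock)
in the large-amplitude regime Fν² > ν+1. -/
theorem stmt_7 (F H_R ν : ℝ) (hF0 : 0 < F) (hF2 : F < 2) (hHR : 0 < H_R) (hν : 1 < ν)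
    (hlarge : ν + 1 < F * ν ^ 2)
    (q₀ H_L H₃ H_s H_star : ℝ)
    (hq0 : q₀ = (ν ^ 2 / (ν + 1)) * H_R ^ ((3:ℝ)/2))
    (hHL : H_L = ν ^ 2 * H_R)
    (hH3 : H₃ = (ν ^ 2 / (ν + 1) ^ 2) * H_R)
    (hHs : H_s = (F * ν ^ 2 / (ν + 1)) ^ ((2:ℝ)/3) * H_R)
    (hHstar : H_star = ((-(ν + 1) + Real.sqrt (8 * F ^ 2 * ν ^ 4 + ν ^ 2 + 2 * ν + 1)) /
      (2 * (ν + 1))) * H_R)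
    (G : ℝ → ℝ)
    (hG : ∀ H, G H = F ^ 2 * (H - H_L) * (H - H_R) * (H - H₃) /
      ((H - H_s) * (H ^ 2 + H * H_s + H_s ^ 2))) :
    (H_R < H_s ∧ H_s < H_star ∧ H_star < H_L) ∧
    (∃ H : ℝ → ℝ, StrictAntiOn H (Set.Iic 0) ∧ H 0 = H_star ∧
      (∀ x < (0:ℝ), H x ∈ Set.Ioo H_star H_L) ∧
      (∀ x ≤ (0:ℝ), HasDerivAt H (G (H x)) x) ∧
      Tendsto H atBot (nhds H_L)) ∧
    (-q₀ / H_star - Real.sqrt H_star / F < 0 ∧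
      0 < -q₀ / H_star + Real.sqrt H_star / F ∧
      -q₀ / H_R + Real.sqrt H_R / F < 0) := by
  have hν0 : 0 < ν := by linarith
  have hn1 : 0 < ν + 1 := by linarith
  set a := F * ν ^ 2 / (ν + 1) with ha
  have ha1 : 1 < a := by rw [ha, lt_div_iff₀ hn1]; linarith
  have ha0 : 0 < a := by linarith
  set s := a ^ ((2:ℝ)/3) with hs
  have hs1 : 1 < s := Real.one_lt_rpow ha1 (by norm_num)
  have hs3 : s ^ 3 = a ^ 2 := by
    rw [hs, ← Real.rpow_natCast, ← Real.rpow_mul ha0.le, ← Real.rpow_natCast]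
    norm_num
  set k := (-(ν + 1) + Real.sqrt (8 * F ^ 2 * ν ^ 4 + ν ^ 2 + 2 * ν + 1)) /
      (2 * (ν + 1)) with hk
  have haν : a * (ν + 1) = F * ν ^ 2 := by rw [ha]; field_simp
  have hkr : 2 * k + 1 = Real.sqrt (8 * a ^ 2 + 1) := by
    have : 8 * F ^ 2 * ν ^ 4 + ν ^ 2 + 2 * ν + 1 = (8 * a ^ 2 + 1) * (ν + 1) ^ 2 := by
      linear_combination (-8) * (a * (ν + 1) + F * ν ^ 2) * haν
    rw [hk, this, Real.sqrt_mul (by positivity), Real.sqrt_sq hn1.le]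
    field_simp
    ring
  have hkpos : 0 < 2 * k + 1 := by rw [hkr]; positivity
  have hkq : k ^ 2 + k = 2 * s ^ 3 := by
    have := Real.sq_sqrt (show 0 ≤ 8 * a ^ 2 + 1 by positivity)
    rw [← hkr] at this
    rw [hs3]; linarith
  have hsk : s < k := by
    by_contra h
    push Not at h
    have : s ^ 2 < s ^ 3 := by nlinarith [sq_nonneg s]
    have : s < s ^ 3 := by nlinarith [sq_nonneg s]
    nlinarith
  have hkν : k < ν ^ 2 := by
    by_contra h
    push Not at h
    have h1 : ν ^ 4 + ν ^ 2 ≤ 2 * a ^ 2 := by rw [← hs3, ← hkq]; nlinarith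
    have h2 : a ^ 2 * (ν + 1) ^ 2 = F ^ 2 * ν ^ 4 := by
      linear_combination (a * (ν + 1) + F * ν ^ 2) * haν
    have h3 : F ^ 2 < 4 := by nlinarith
    have h4 : a ^ 2 * (ν + 1) ^ 2 < 4 * ν ^ 4 := by
      rw [h2]; exact mul_lt_mul_of_pos_right h3 (by positivity)
    have h5 : a ^ 2 * (4 * ν) ≤ a ^ 2 * (ν + 1) ^ 2 :=
      mul_le_mul_of_nonneg_left (by nlinarith [sq_nonneg (ν - 1)]) (by positivity)
    have h6 : a ^ 2 < ν ^ 3 := by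
      have : a ^ 2 * (4 * ν) < ν ^ 3 * (4 * ν) := by linarith
      exact lt_of_mul_lt_mul_right this (by positivity)
    have h7 : 0 ≤ ν ^ 4 - 2 * ν ^ 3 + ν ^ 2 := by
      have := mul_nonneg (sq_nonneg ν) (sq_nonneg (ν - 1))
      linarith [show ν ^ 2 * (ν - 1) ^ 2 = ν ^ 4 - 2 * ν ^ 3 + ν ^ 2 by ring]
    linarith
  have o1 : H_R < H_s := by rw [hHs]; exact lt_mul_of_one_lt_left hHR hs1
  have o2 : H_s < H_star := by
    rw [hHs, hHstar]; exact mul_lt_mul_of_pos_right hsk hHR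
  have o3 : H_star < H_L := by
    rw [hHL, hHstar]; exact mul_lt_mul_of_pos_right hkν hHR
  have o4 : H₃ < H_R := by
    rw [hH3]
    have : ν ^ 2 / (ν + 1) ^ 2 < 1 := by
      rw [div_lt_one (by positivity)]; nlinarith
    exact mul_lt_of_lt_one_left hHR this
  have o5 : 0 < H₃ := by rw [hH3]; positivity
  have hst0 : 0 < H_star := by linarith
  have hq : q₀ = a * (H_R * Real.sqrt H_R) / F := by
    rw [hq0, show (3:ℝ)/2 = 1 + 1/2 by norm_num, Real.rpow_add hHR, Real.rpow_one,
      ← Real.sqrt_eq_rpow, ha]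
    field_simp
  have hqpos : 0 < q₀ := by rw [hq]; positivity
  refine ⟨⟨o1, o2, o3⟩, profile_exists F H₃ H_R H_s H_star H_L hF0 o5 o4 o1 o2 o3 G hG,
    ?_, ?_, ?_⟩
  · have h1 : 0 < q₀ / H_star := by positivity
    have h2 : 0 < Real.sqrt H_star / F := by positivity
    rw [neg_div]; linarith
  · have key : a * (H_R * Real.sqrt H_R) < H_star * Real.sqrt H_star := by
      apply lt_of_pow_lt_pow_left₀ 2 (by positivity)
      rw [mul_pow, mul_pow, mul_pow, Real.sq_sqrt hHR.le, Real.sq_sqrt hst0.le, ← hs3]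
      have : H_s ^ 3 < H_star ^ 3 := by
        apply pow_lt_pow_left₀ o2 (by linarith) (by norm_num)
      rw [hHs, mul_pow] at this
      linarith [show s ^ 3 * (H_R ^ 2 * H_R) = s ^ 3 * H_R ^ 3 by ring,
        show H_star ^ 2 * H_star = H_star ^ 3 by ring]
    have : q₀ / H_star < Real.sqrt H_star / F := by
      rw [hq, div_div, div_lt_div_iff₀ (by positivity) hF0]
      linarith [mul_lt_mul_of_pos_right key hF0,
        show Real.sqrt H_star * (F * H_star) = H_star * Real.sqrt H_star * F by ring]
    rw [neg_div]; linarith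
  · have : Real.sqrt H_R / F < q₀ / H_R := by
      have e : q₀ / H_R = a * (Real.sqrt H_R / F) := by rw [hq]; field_simp
      have : 0 < Real.sqrt H_R / F := by positivity
      rw [e]; exact lt_mul_of_one_lt_left this ha1
    rw [neg_div]; linarith
end

section
/- Let H>0, Q>0, F>0 and c∈ℝ, and define the real 2×2 matrices A=[[−c, 1],[H/F²−Q²/H², 2Q/H−c]], E=[[0, 0],[2Q²/H³+1, −2Q/H²]], and A⁰=[[2Q(F²H³+F²Q²+H³)/(F²H), −(H³+2Q²)],[−(H³+2Q²), 2HQ]]. Then A⁰ is symmetric, A⁰A is symmetric, A⁰E is symmetric, and A⁰E is negative semidefinite (v·(A⁰E)v ≤ 0 for all v∈ℝ²). If in addition 2Q>F·H^{3/2}, then A⁰ is positive definite. -/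
open scoped Matrix

/-- Simultaneous symmetrizability (Kawashima class) of the Saint-Venant equations:
A⁰ symmetrizes both the hyperbolic and relaxation parts, with dissipative relaxation. -/
theorem stmt_8 (H Q F c : ℝ) (hH : 0 < H) (hQ : 0 < Q) (hF : 0 < F)
    (A E A0 : Matrix (Fin 2) (Fin 2) ℝ)
    (hA : A = !![-c, 1; H / F ^ 2 - Q ^ 2 / H ^ 2, 2 * Q / H - c])
    (hE : E = !![0, 0; 2 * Q ^ 2 / H ^ 3 + 1, -2 * Q / H ^ 2])
    (hA0 : A0 = !![2 * Q * (F ^ 2 * H ^ 3 + F ^ 2 * Q ^ 2 + H ^ 3) / (F ^ 2 * H),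
      -(H ^ 3 + 2 * Q ^ 2); -(H ^ 3 + 2 * Q ^ 2), 2 * H * Q]) :
    A0.IsSymm ∧ (A0 * A).IsSymm ∧ (A0 * E).IsSymm ∧
    (∀ v : Fin 2 → ℝ, v ⬝ᵥ (A0 * E).mulVec v ≤ 0) ∧
    (F * H ^ ((3:ℝ)/2) < 2 * Q → A0.PosDef) := by
  have h0 := hH.ne'
  have f0 := hF.ne'
  subst hA hE hA0
  refine ⟨?_, ?_, ?_, ?_, ?_⟩
  · ext i j
    fin_cases i <;> fin_cases j <;> simp
  · ext i j
    fin_cases i <;> fin_cases j <;>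
      simp [Matrix.mul_apply, Fin.sum_univ_two] <;> field_simp <;> ring
  · ext i j
    fin_cases i <;> fin_cases j <;>
      simp [Matrix.mul_apply, Fin.sum_univ_two] <;> field_simp <;> ring
  · intro v
    have key : v ⬝ᵥ (!![2 * Q * (F ^ 2 * H ^ 3 + F ^ 2 * Q ^ 2 + H ^ 3) / (F ^ 2 * H),
        -(H ^ 3 + 2 * Q ^ 2); -(H ^ 3 + 2 * Q ^ 2), 2 * H * Q] *
        !![0, 0; 2 * Q ^ 2 / H ^ 3 + 1, -2 * Q / H ^ 2]).mulVec v
        = -(((H ^ 3 + 2 * Q ^ 2) * v 0 - 2 * Q * H * v 1) ^ 2 / H ^ 3) := by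
      simp [Matrix.mulVec, dotProduct, Matrix.mul_apply, Fin.sum_univ_two]
      field_simp
      ring
    rw [key]
    have : 0 ≤ ((H ^ 3 + 2 * Q ^ 2) * v 0 - 2 * Q * H * v 1) ^ 2 / H ^ 3 := by positivity
    linarith
  · intro h
    have hsq : (H ^ ((3:ℝ)/2)) ^ 2 = H ^ 3 := by
      rw [← Real.rpow_natCast, ← Real.rpow_mul hH.le, ← Real.rpow_natCast]
      norm_num
    have hp : 0 < H ^ ((3:ℝ)/2) := Real.rpow_pos_of_pos hH _
    have h2 : F ^ 2 * H ^ 3 < 4 * Q ^ 2 := by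
      rw [← hsq]
      nlinarith [mul_pos hF hp]
    apply Matrix.PosDef.of_dotProduct_mulVec_pos
    · ext i j
      fin_cases i <;> fin_cases j <;> simp
    · intro v hv
      have key : star v ⬝ᵥ (!![2 * Q * (F ^ 2 * H ^ 3 + F ^ 2 * Q ^ 2 + H ^ 3) / (F ^ 2 * H),
          -(H ^ 3 + 2 * Q ^ 2); -(H ^ 3 + 2 * Q ^ 2), 2 * H * Q]).mulVec v
          = ((2 * H * Q * v 1 - (H ^ 3 + 2 * Q ^ 2) * v 0) ^ 2
            + H ^ 3 * (4 * Q ^ 2 - F ^ 2 * H ^ 3) / F ^ 2 * v 0 ^ 2) / (2 * H * Q) := by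
        simp [Matrix.mulVec, dotProduct, Fin.sum_univ_two]
        field_simp
        ring
      rw [key]
      have hd : 0 < H ^ 3 * (4 * Q ^ 2 - F ^ 2 * H ^ 3) / F ^ 2 := by
        have : 0 < 4 * Q ^ 2 - F ^ 2 * H ^ 3 := by linarith
        positivity
      apply div_pos _ (by positivity)
      by_cases hx : v 0 = 0
      · have hy : v 1 ≠ 0 := by
          intro hy
          apply hv
          ext i
          fin_cases i <;> simp [hx, hy]
        rw [hx]
        have : 0 < (2 * H * Q * v 1) ^ 2 := by positivity
        simpa using this
      · have : 0 < v 0 ^ 2 := by positivity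
        have := mul_pos hd this
        positivity
end

section
/- Let n≥1, let D be a real diagonal n×n matrix with pairwise distinct diagonal entries d₁,…,dₙ, and let E be any real n×n matrix. Then there exists a skew-symmetric real n×n matrix K such that the symmetric part of E−KD equals the diagonal part of E, i.e., ((E−KD)+(E−KD)ᵀ)/2 = diag(E₁₁,…,Eₙₙ). -/
open scoped Matrix

/-- Kawashima-type compensating matrix lemma: there is a skew-symmetric K such that the
symmetric part of E - K·D is the diagonal part of E. -/
theorem stmt_9 (n : ℕ) (hn : 1 ≤ n) (d : Fin n → ℝ) (hd : Function.Injective d)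
    (E : Matrix (Fin n) (Fin n) ℝ) :
    ∃ K : Matrix (Fin n) (Fin n) ℝ, Kᵀ = -K ∧
      ((1:ℝ)/2) • ((E - K * Matrix.diagonal d) + (E - K * Matrix.diagonal d)ᵀ) =
        Matrix.diagonal (fun i => E i i) := by
  refine ⟨Matrix.of fun i j => (E i j + E j i) / (d j - d i), ?_, ?_⟩
  · ext i j
    simp only [Matrix.transpose_apply, Matrix.of_apply, Matrix.neg_apply]
    rw [← neg_sub (d j) (d i), div_neg, add_comm]
  · ext i j
    simp only [Matrix.smul_apply, Matrix.add_apply, Matrix.sub_apply, Matrix.transpose_apply,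
      Matrix.mul_diagonal, Matrix.of_apply, smul_eq_mul]
    by_cases h : i = j
    · subst h
      simp
      ring
    · rw [Matrix.diagonal_apply_ne _ h]
      have h1 : d j - d i ≠ 0 := sub_ne_zero.mpr fun e => h (hd e).symm
      rw [← neg_sub (d j) (d i), div_neg]
      field_simp
      ring
end

section
/- Let n≥1, let A⁰ be a symmetric positive definite real n×n matrix and A a real n×n matrix such that A⁰A is symmetric. Then there exists an invertible real n×n matrix L such that LᵀL = A⁰ and L·A·L⁻¹ is a diagonal matrix. -/
open scoped Matrix

/-- Correspondence between positive definite symmetrizers and diagonalizing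
transformations: L may be chosen with LᵀL = A⁰ and L·A·L⁻¹ diagonal. -/
theorem stmt_10 (n : ℕ) (hn : 1 ≤ n) (A0 A : Matrix (Fin n) (Fin n) ℝ)
    (hpd : A0.PosDef) (hsym : (A0 * A).IsSymm) :
    ∃ L : Matrix (Fin n) (Fin n) ℝ, IsUnit L.det ∧ Lᵀ * L = A0 ∧
      ∃ d : Fin n → ℝ, L * A * L⁻¹ = Matrix.diagonal d := by
  obtain ⟨B, hB⟩ : ∃ B : Matrix (Fin n) (Fin n) ℝ, A0 = Bᵀ * B := by
    open scoped MatrixOrder in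
    obtain ⟨B, hB⟩ := CStarAlgebra.nonneg_iff_eq_star_mul_self.mp hpd.posSemidef.nonneg
    exact ⟨B, by rw [hB, Matrix.star_eq_conjTranspose, Matrix.conjTranspose_eq_transpose_of_trivial]⟩
  have hBu : IsUnit B.det := by
    have h := hpd.det_pos.ne'
    rw [hB, Matrix.det_mul, Matrix.det_transpose] at h
    exact isUnit_iff_ne_zero.mpr (left_ne_zero_of_mul h)
  have hBtu : IsUnit Bᵀ.det := by rwa [Matrix.det_transpose]
  have hM : (B * A * B⁻¹).IsHermitian := by
    have h1 : B * A * B⁻¹ = (B⁻¹)ᵀ * (A0 * A) * B⁻¹ := by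
      rw [hB, Matrix.transpose_nonsing_inv, Matrix.mul_assoc Bᵀ B A,
        Matrix.nonsing_inv_mul_cancel_left _ _ hBtu]
    rw [Matrix.IsHermitian, Matrix.conjTranspose_eq_transpose_of_trivial, h1,
      Matrix.transpose_mul, Matrix.transpose_mul, hsym.eq, Matrix.transpose_transpose,
      Matrix.mul_assoc, Matrix.mul_assoc, Matrix.mul_assoc]
  have hs := hM.conjStarAlgAut_star_eigenvectorUnitary
  rw [Unitary.conjStarAlgAut_apply] at hs
  obtain ⟨U, hU⟩ : ∃ U : Matrix (Fin n) (Fin n) ℝ, U = hM.eigenvectorUnitary := ⟨_, rfl⟩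
  have hUU : U * Uᵀ = 1 := by
    have := Unitary.coe_mul_star_self hM.eigenvectorUnitary
    rwa [Unitary.coe_star, ← hU, Matrix.star_eq_conjTranspose,
      Matrix.conjTranspose_eq_transpose_of_trivial] at this
  have hUU' : Uᵀ * U = 1 := mul_eq_one_comm.mp hUU
  simp only [Unitary.coe_star, Matrix.transpose_transpose, ← hU, Matrix.star_eq_conjTranspose,
      Matrix.conjTranspose_eq_transpose_of_trivial] at hs
  refine ⟨Uᵀ * B, ?_, ?_, RCLike.ofReal ∘ hM.eigenvalues, ?_⟩
  · rw [Matrix.det_mul]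
    exact (IsUnit.of_mul_eq_one U.det (by rw [← Matrix.det_mul, hUU', Matrix.det_one])).mul hBu
  · rw [Matrix.transpose_mul, Matrix.transpose_transpose, Matrix.mul_assoc,
      ← Matrix.mul_assoc U, hUU, Matrix.one_mul, hB]
  · rw [Matrix.mul_inv_rev, Matrix.inv_eq_right_inv hUU', ← Matrix.mul_assoc]
    simp only [Matrix.mul_assoc] at hs ⊢
    exact hs
end

section
/- Let n≥1 and 1≤k≤n. Let A be a real n×n matrix and S an invertible real n×n matrix with SAS⁻¹ = D diagonal, where the diagonal entries satisfy d₁,…,d_k<0<d_{k+1},…,dₙ. Let b be a real k×n matrix whose restriction to the stable subspace V⁻ := S⁻¹(span{e₁,…,e_k}) is injective (i.e., v∈V⁻ and bv=0 imply v=0). Then there exists a symmetric positive definite real n×n matrix A⁰ such that A⁰A is symmetric and v·(A⁰A)v>0 for every nonzero v∈ker b. -/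
open scoped Matrix

/-- Quantitative form of the Lopatinsky condition. -/
theorem lop_bound (n k : ℕ) (B : Matrix (Fin k) (Fin n) ℝ)
    (hB : ∀ w : Fin n → ℝ, (∀ i : Fin n, k ≤ (i : ℕ) → w i = 0) → B.mulVec w = 0 → w = 0) :
    ∃ K : ℝ, ∀ w : Fin n → ℝ, B.mulVec w = 0 → ∀ i,
      (w i) ^ 2 ≤ K ^ 2 * ∑ j : Fin n, (if (j : ℕ) < k then 0 else (w j) ^ 2) := by
  let P : (Fin n → ℝ) →ₗ[ℝ] (Fin n → ℝ) :=
    Matrix.toLin' (Matrix.diagonal (fun j : Fin n => if (j : ℕ) < k then (0 : ℝ) else 1))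
  have hP : ∀ w j, P w j = if (j : ℕ) < k then 0 else w j := by
    intro w j
    simp only [P, Matrix.toLin'_apply, Matrix.mulVec_diagonal]
    split_ifs <;> simp
  let f : (Fin n → ℝ) →ₗ[ℝ] (Fin k → ℝ) × (Fin n → ℝ) := (Matrix.toLin' B).prod P
  have hf : LinearMap.ker f = ⊥ := by
    rw [LinearMap.ker_eq_bot']
    intro w hw
    have h1 : B.mulVec w = 0 := by simpa [f] using congrArg Prod.fst hw
    have h2 : P w = 0 := by simpa [f] using congrArg Prod.snd hw
    refine hB w (fun i hi => ?_) h1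
    have := hP w i
    rw [h2, if_neg (not_lt.mpr hi)] at this
    simpa using this.symm
  obtain ⟨K, -, hK⟩ := LinearMap.exists_antilipschitzWith f hf
  refine ⟨K, fun w hw i => ?_⟩
  have h0 : ‖w‖ ≤ K * ‖f w‖ := by
    simpa using ZeroHomClass.bound_of_antilipschitz f hK w
  have h1 : f w = (0, P w) := by simp [f, hw]
  rw [h1, Prod.norm_mk, norm_zero, max_eq_right (norm_nonneg _)] at h0
  have hs : ∀ j, (P w j) ^ 2 = if (j : ℕ) < k then 0 else (w j) ^ 2 := by
    intro j
    rw [hP]; split_ifs <;> simp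
  have h2 : ‖P w‖ ≤ Real.sqrt (∑ j, (P w j) ^ 2) := by
    rw [pi_norm_le_iff_of_nonneg (Real.sqrt_nonneg _)]
    intro j
    apply Real.le_sqrt_of_sq_le
    rw [Real.norm_eq_abs, sq_abs]
    exact Finset.single_le_sum (f := fun j => (P w j) ^ 2) (fun _ _ => sq_nonneg _)
      (Finset.mem_univ j)
  have h3 : |w i| ≤ K * Real.sqrt (∑ j, (P w j) ^ 2) :=
    ((norm_le_pi_norm w i).trans h0).trans (mul_le_mul_of_nonneg_left h2 K.2)
  have h4 := pow_le_pow_left₀ (abs_nonneg _) h3 2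
  rw [sq_abs, mul_pow, Real.sq_sqrt (Finset.sum_nonneg fun _ _ => sq_nonneg _)] at h4
  simpa only [hs] using h4

/-- Existence of a symmetrizer making Lopatinsky-stable boundary conditions maximally
dissipative: A⁰A positive definite on ker b. -/
theorem stmt_12 (n k : ℕ) (hk1 : 1 ≤ k) (hkn : k ≤ n)
    (A S : Matrix (Fin n) (Fin n) ℝ) (hS : IsUnit S.det)
    (d : Fin n → ℝ) (hdiag : S * A * S⁻¹ = Matrix.diagonal d)
    (hneg : ∀ i : Fin n, (i : ℕ) < k → d i < 0)
    (hposd : ∀ i : Fin n, k ≤ (i : ℕ) → 0 < d i)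
    (b : Matrix (Fin k) (Fin n) ℝ)
    (hinj : ∀ w : Fin n → ℝ, (∀ i : Fin n, k ≤ (i : ℕ) → w i = 0) →
      b.mulVec (S⁻¹.mulVec w) = 0 → S⁻¹.mulVec w = 0) :
    ∃ A0 : Matrix (Fin n) (Fin n) ℝ, A0.PosDef ∧ (A0 * A).IsSymm ∧
      ∀ v : Fin n → ℝ, v ≠ 0 → b.mulVec v = 0 → 0 < v ⬝ᵥ (A0 * A).mulVec v := by
  have hSS : S * S⁻¹ = 1 := Matrix.mul_nonsing_inv S hS
  have hSS' : S⁻¹ * S = 1 := Matrix.nonsing_inv_mul S hS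
  have hSinj : Function.Injective S.mulVec := by
    intro x y h
    have := congrArg S⁻¹.mulVec h
    simpa [Matrix.mulVec_mulVec, hSS'] using this
  obtain ⟨K, hK⟩ := lop_bound n k (b * S⁻¹) (by
    intro w hw h
    have h1 := hinj w hw (by rwa [Matrix.mulVec_mulVec])
    have := congrArg S.mulVec h1
    simpa [Matrix.mulVec_mulVec, hSS] using this)
  set M : ℝ := n * K ^ 2 + 1 with hM
  have hMpos : 0 < M := by positivity
  set c : Fin n → ℝ := fun i => if (i : ℕ) < k then -(1 / M) else 1 with hc
  have hd : ∀ i, d i ≠ 0 := fun i => by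
    rcases lt_or_ge (i : ℕ) k with h | h
    · exact (hneg i h).ne
    · exact (hposd i h).ne'
  set e : Fin n → ℝ := fun i => c i / d i with he
  have hepos : ∀ i, 0 < e i := fun i => by
    rcases lt_or_ge (i : ℕ) k with h | h
    · simp only [he, hc, if_pos h]
      exact div_pos_of_neg_of_neg (by simpa using hMpos) (hneg i h)
    · simp only [he, hc, if_neg (not_lt.mpr h)]
      exact div_pos one_pos (hposd i h)
  have hSA : S * A = Matrix.diagonal d * S := by
    rw [← hdiag, Matrix.mul_assoc, hSS', Matrix.mul_one]
  have hA0A : Sᵀ * Matrix.diagonal e * S * A = Sᵀ * Matrix.diagonal c * S := by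
    rw [Matrix.mul_assoc, hSA, ← Matrix.mul_assoc, Matrix.mul_assoc Sᵀ,
      Matrix.diagonal_mul_diagonal]
    congr 4
    funext i
    exact div_mul_cancel₀ _ (hd i)
  refine ⟨Sᵀ * Matrix.diagonal e * S, ?_, ?_, ?_⟩
  · have := (Matrix.PosDef.diagonal hepos).conjTranspose_mul_mul_same hSinj
    rwa [Matrix.conjTranspose_eq_transpose_of_trivial] at this
  · rw [hA0A, Matrix.IsSymm]
    simp [Matrix.transpose_mul, Matrix.mul_assoc]
  · intro v hv hbv
    set w := S.mulVec v with hw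
    have hform : v ⬝ᵥ (Sᵀ * Matrix.diagonal e * S * A).mulVec v = ∑ i, c i * (w i) ^ 2 := by
      rw [hA0A, ← Matrix.mulVec_mulVec, ← Matrix.mulVec_mulVec, Matrix.dotProduct_mulVec,
        Matrix.vecMul_transpose]
      simp only [dotProduct, Matrix.mulVec_diagonal, ← hw]
      exact Finset.sum_congr rfl fun i _ => by ring
    have hw0 : w ≠ 0 := fun h => hv (hSinj (by simpa [hw] using h))
    have hKw := hK w (by
      rw [hw, Matrix.mulVec_mulVec, Matrix.mul_assoc, hSS', Matrix.mul_one, hbv])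
    rw [hform]
    set q := ∑ j : Fin n, (if (j : ℕ) < k then 0 else (w j) ^ 2) with hq
    have hq0 : 0 ≤ q := Finset.sum_nonneg fun j _ => by split_ifs <;> positivity
    have hqpos : 0 < q := by
      rcases hq0.lt_or_eq with h | h
      · exact h
      · exfalso
        apply hw0
        funext i
        have := hKw i
        rw [← h, mul_zero] at this
        exact pow_eq_zero_iff (two_ne_zero) |>.1 (le_antisymm this (sq_nonneg _))
    have hlow : q - ∑ _i : Fin n, 1 / M * (K ^ 2 * q) ≤ ∑ i, c i * (w i) ^ 2 := by
      rw [hq, ← Finset.sum_sub_distrib, ← hq]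
      refine Finset.sum_le_sum fun i _ => ?_
      have h1 : 1 / M * (w i) ^ 2 ≤ 1 / M * (K ^ 2 * q) :=
        mul_le_mul_of_nonneg_left (hKw i) (by positivity)
      have h2 : 0 ≤ 1 / M * (K ^ 2 * q) := by positivity
      simp only [hc]
      split_ifs <;> linarith
    refine lt_of_lt_of_le ?_ hlow
    have : q - ∑ _i : Fin n, 1 / M * (K ^ 2 * q) = q / M := by
      simp only [Finset.sum_const, Finset.card_univ, Fintype.card_fin, nsmul_eq_mul]
      field_simp
      rw [hM]; ring
    rw [this]
    positivity
end

section
/- Let 0<F<2, H_R>0 and ν>1, set H_L=ν²H_R and c=((ν²+ν+1)/(ν+1))·√H_R, and define the complex 2×2 matrices A₋=[[−c, 1],[H_L/F²−H_L, 2√H_L−c]] and E₋=[[0, 0],[3, −2/√H_L]]. Then for every λ∈ℂ with Re λ>0 there exist γ₁,γ₂∈ℂ with Re γ₁>0>Re γ₂ such that for all γ∈ℂ: det(E₋−λ·I−γ·A₋) = det(A₋)·(γ−γ₁)(γ−γ₂). -/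
/-- A sufficient condition for the roots of `d γ² - B γ - C` to split. -/
theorem aux_split (d : ℝ) (hd : 0 < d) (B C : ℂ)
    (h : 0 < B.re ^ 2 * C.re + B.re * B.im * C.im + d * C.im ^ 2 ∨
      (B.re = 0 ∧ 0 < 4 * d * C.re - B.im ^ 2)) :
    ∃ γ₁ γ₂ : ℂ, 0 < γ₁.re ∧ γ₂.re < 0 ∧ (d : ℂ) * (γ₁ + γ₂) = B ∧ (d : ℂ) * (γ₁ * γ₂) = -C := by
  obtain ⟨r, hr0, hr⟩ : ∃ r : ℂ, 0 ≤ r.re ∧ r ^ 2 = B ^ 2 + 4 * d * C := by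
    obtain ⟨r, hr⟩ := IsAlgClosed.exists_pow_nat_eq (B ^ 2 + 4 * d * C) (n := 2) (by norm_num)
    rcases le_total 0 r.re with h0 | h0
    · exact ⟨r, h0, hr⟩
    · exact ⟨-r, by simpa using h0, by rw [neg_sq, hr]⟩
  have hre := congrArg Complex.re hr
  have him := congrArg Complex.im hr
  simp [pow_two] at hre him
  have hlt : B.re ^ 2 < r.re ^ 2 := by
    rcases h with h | ⟨h1, h2⟩
    · by_contra hcon
      push Not at hcon
      have h3 : 0 ≤ (B.re ^ 2 - r.re ^ 2) * (B.re ^ 2 + r.im ^ 2) :=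
        mul_nonneg (by linarith) (by positivity)
      have h4 : (B.re ^ 2 - r.re ^ 2) * (B.re ^ 2 + r.im ^ 2)
          = -(4 * d * (B.re ^ 2 * C.re + B.re * B.im * C.im + d * C.im ^ 2)) := by
        have e1 : r.re * r.im = B.re * B.im + 2 * d * C.im := by linarith
        have e2 : (r.re * r.im) ^ 2 = (B.re * B.im + 2 * d * C.im) ^ 2 := by rw [e1]
        linear_combination (-B.re ^ 2) * hre - e2
      have : 0 < 4 * d * (B.re ^ 2 * C.re + B.re * B.im * C.im + d * C.im ^ 2) := by positivity
      linarith
    · rw [h1] at hre ⊢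
      nlinarith [sq_nonneg r.im]
  have habs := abs_lt_of_sq_lt_sq hlt hr0
  have hab := abs_lt.mp habs
  have hdc : (d : ℂ) ≠ 0 := by exact_mod_cast hd.ne'
  refine ⟨((1 / (2 * d) : ℝ) : ℂ) * (B + r), ((1 / (2 * d) : ℝ) : ℂ) * (B - r), ?_, ?_, ?_, ?_⟩
  · rw [Complex.re_ofReal_mul, Complex.add_re]
    exact mul_pos (by positivity) (by linarith [hab.1])
  · rw [Complex.re_ofReal_mul, Complex.sub_re]
    exact mul_neg_of_pos_of_neg (by positivity) (by linarith [hab.2])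
  · push_cast
    field_simp
    ring
  · push_cast
    field_simp
    linear_combination -hr

/-- Consistent splitting at -∞: for Re λ > 0, det(E₋ - λI - γA₋) factors with one root of
positive and one root of negative real part. -/
theorem stmt_15 (F H_R ν : ℝ) (hF0 : 0 < F) (hF2 : F < 2) (hHR : 0 < H_R) (hν : 1 < ν)
    (H_L : ℝ) (hHL : H_L = ν ^ 2 * H_R)
    (c : ℝ) (hc : c = ((ν ^ 2 + ν + 1) / (ν + 1)) * Real.sqrt H_R)
    (Aminus Eminus : Matrix (Fin 2) (Fin 2) ℂ)
    (hA : Aminus = !![((-c : ℝ) : ℂ), 1;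
      ((H_L / F ^ 2 - H_L : ℝ) : ℂ), ((2 * Real.sqrt H_L - c : ℝ) : ℂ)])
    (hE : Eminus = !![0, 0; 3, ((-2 / Real.sqrt H_L : ℝ) : ℂ)]) :
    ∀ lam : ℂ, 0 < lam.re → ∃ γ₁ γ₂ : ℂ, 0 < γ₁.re ∧ γ₂.re < 0 ∧
      ∀ γ : ℂ, (Eminus - lam • (1 : Matrix (Fin 2) (Fin 2) ℂ) - γ • Aminus).det =
        Aminus.det * (γ - γ₁) * (γ - γ₂) := by
  intro lam hlam
  obtain ⟨s, hs, rfl⟩ : ∃ s : ℝ, 0 < s ∧ H_R = s ^ 2 :=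
    ⟨√H_R, Real.sqrt_pos.mpr hHR, (Real.sq_sqrt hHR.le).symm⟩
  have hν0 : 0 < ν := by linarith
  obtain ⟨u, hu⟩ : ∃ u : ℝ, u = ν * s := ⟨_, rfl⟩
  have hu0 : 0 < u := by rw [hu]; positivity
  have hHL' : H_L = u ^ 2 := by rw [hHL, hu]; ring
  rw [Real.sqrt_sq hs.le] at hc
  obtain ⟨k, hk⟩ : ∃ k : ℝ, k = s / (ν + 1) := ⟨_, rfl⟩
  have hk0 : 0 < k := by rw [hk]; positivity
  have hck : c = u + k := by
    rw [hc, hu, hk]; field_simp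
  have hsq : √H_L = u := by rw [hHL', Real.sqrt_sq hu0.le]
  rw [hsq] at hA hE
  obtain ⟨d, hd⟩ : ∃ d : ℝ, d = u ^ 2 / F ^ 2 - k ^ 2 := ⟨_, rfl⟩
  have hd0 : 0 < d := by
    have h1 : k < u / F := by
      rw [lt_div_iff₀ hF0]
      have : k * (ν + 1) = s := by rw [hk]; field_simp
      have h2 : k * F < k * (ν + 1) := by
        apply mul_lt_mul_of_pos_left _ hk0; linarith
      nlinarith
    have h2 : k ^ 2 < (u / F) ^ 2 := by gcongr
    rw [div_pow] at h2
    linarith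
  obtain ⟨m, hm⟩ : ∃ m : ℝ, m = lam.re + 1 / u := ⟨_, rfl⟩
  have hu1 : 0 < 1 / u := by positivity
  have hm0 : 0 < m := by linarith
  obtain ⟨B, hB⟩ : ∃ B : ℂ, B = ((1 - 2 * k / u : ℝ) : ℂ) - ((2 * k : ℝ) : ℂ) * lam := ⟨_, rfl⟩
  obtain ⟨C, hC⟩ : ∃ C : ℂ, C = lam * lam + ((2 / u : ℝ) : ℂ) * lam := ⟨_, rfl⟩
  have hBre : B.re = 1 - 2 * k * m := by
    rw [hB, Complex.sub_re, Complex.re_ofReal_mul, Complex.ofReal_re, hm]; ring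
  have hBim : B.im = - 2 * k * lam.im := by
    rw [hB, Complex.sub_im, Complex.im_ofReal_mul, Complex.ofReal_im]; ring
  have hCre : C.re = m ^ 2 - (1 / u) ^ 2 - lam.im ^ 2 := by
    rw [hC, Complex.add_re, Complex.re_ofReal_mul, Complex.mul_re, hm]; ring
  have hCim : C.im = 2 * m * lam.im := by
    rw [hC, Complex.add_im, Complex.im_ofReal_mul, Complex.mul_im, hm]; ring
  have hm1 : 0 < m ^ 2 - (1 / u) ^ 2 := by
    have : (1 / u) ^ 2 < m ^ 2 := by gcongr; linarith
    linarith
  have hkey : 0 < 4 * m ^ 2 * (u ^ 2 / F ^ 2) - 1 := by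
    have h1 : 1 < m * u := by
      have : 1 / u < m := by linarith
      rwa [div_lt_iff₀ hu0] at this
    have h2 : 1 < 2 * (m * u) / F := by
      rw [lt_div_iff₀ hF0]; linarith
    have h3 : 1 < (2 * (m * u) / F) ^ 2 := one_lt_pow₀ h2 (by norm_num)
    have h4 : (2 * (m * u) / F) ^ 2 = 4 * m ^ 2 * (u ^ 2 / F ^ 2) := by
      field_simp; ring
    linarith
  have hid : B.re ^ 2 * C.re + B.re * B.im * C.im + d * C.im ^ 2
      = B.re ^ 2 * (m ^ 2 - (1 / u) ^ 2)
        + lam.im ^ 2 * (4 * m ^ 2 * (u ^ 2 / F ^ 2) - 1) := by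
    rw [hBre, hBim, hCre, hCim, hd]; ring
  obtain ⟨γ₁, γ₂, h1, h2, h3, h4⟩ := aux_split d hd0 B C (by
    by_cases hy : lam.im = 0
    · by_cases hb : B.re = 0
      · right
        refine ⟨hb, ?_⟩
        rw [hBim, hCre, hy]
        have := mul_pos hd0 hm1
        nlinarith
      · left
        rw [hid]
        have : 0 < B.re ^ 2 := by positivity
        rw [hy]
        have := mul_pos this hm1
        nlinarith
    · left
      rw [hid]
      have : 0 < lam.im ^ 2 := by positivity
      have := mul_pos this hkey
      have := mul_nonneg (sq_nonneg B.re) hm1.le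
      linarith)
  refine ⟨γ₁, γ₂, h1, h2, fun γ => ?_⟩
  have hAdet : Aminus.det = -(d : ℂ) := by
    rw [hA, Matrix.det_fin_two_of, hHL', hck, hd]; push_cast; ring
  rw [hAdet]
  have huc : (u : ℂ) ≠ 0 := by exact_mod_cast hu0.ne'
  have e : (Eminus - lam • (1 : Matrix (Fin 2) (Fin 2) ℂ) - γ • Aminus).det
      = -(d : ℂ) * γ ^ 2 + B * γ + C := by
    rw [hA, hE, Matrix.det_fin_two, hB, hC, hHL', hck, hd]
    simp
    field_simp
    ring
  rw [e]
  linear_combination (-γ) * h3 + h4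
end

section
/- Let a∈ℝ with a≠0, b>0 and υ>0. Then there exists C>0 such that for all t≥1: ∫_ℝ ( ∫₁^t s^{−1−υ} e^{−(as−z)²/(bs)} ds )² dz ≤ C². -/
open MeasureTheory

lemma aux_G (a b : ℝ) (ha : a ≠ 0) (hb : 0 < b) (z t : ℝ) (ht : 1 ≤ t) :
    (∫ s in (1:ℝ)..t, (√s)⁻¹ * Real.exp (-(a * s - z) ^ 2 / (b * s)))
      ≤ 2 / |a| * √(Real.pi * b) := by
  have hα : 0 < |a| := abs_pos.mpr ha
  have hζ : 0 ≤ |z| := abs_nonneg z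
  set φ : ℝ → ℝ := fun s => |a| * √s - |z| * (√s)⁻¹ with hφ
  set φ' : ℝ → ℝ := fun s => |a| * (1 / (2 * √s)) - |z| * (-(1 / (2 * √s)) / (√s) ^ 2) with hφ'
  have hpos : ∀ s ∈ Set.uIcc 1 t, 0 < s := by
    intro s hs
    rw [Set.uIcc_of_le ht] at hs
    linarith [hs.1]
  have hder : ∀ s ∈ Set.uIcc 1 t, HasDerivAt φ (φ' s) s := by
    intro s hs
    have h0 := hpos s hs
    have h1 := Real.hasDerivAt_sqrt h0.ne'
    exact (h1.const_mul |a|).sub ((h1.inv (Real.sqrt_pos.mpr h0).ne').const_mul |z|)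
  have hcont' : ContinuousOn φ' (Set.uIcc 1 t) := by
    intro s hs
    have h0 := Real.sqrt_pos.mpr (hpos s hs)
    apply ContinuousAt.continuousWithinAt
    have h2 : 2 * √s ≠ 0 := by positivity
    have h3 : √s ^ 2 ≠ 0 := by positivity
    simp only [hφ']
    fun_prop (disch := assumption)
  have hsub := intervalIntegral.integral_comp_mul_deriv (g := fun w : ℝ => Real.exp (-b⁻¹ * w ^ 2))
    hder hcont' (by fun_prop)
  have hint : Integrable (fun w : ℝ => Real.exp (-b⁻¹ * w ^ 2)) :=
    integrable_exp_neg_mul_sq (by positivity)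
  have hφcont : ContinuousOn φ (Set.uIcc 1 t) := fun s hs => (hder s hs).continuousAt.continuousWithinAt
  have hφ'nn : ∀ s ∈ Set.Icc 1 t, |a| / 2 * (√s)⁻¹ ≤ φ' s := by
    intro s hs
    have h0 := Real.sqrt_pos.mpr (lt_of_lt_of_le one_pos hs.1)
    have : φ' s = |a| / 2 * (√s)⁻¹ + |z| * (1 / (2 * √s) / (√s) ^ 2) := by
      simp only [hφ']; field_simp; ring
    rw [this]
    have : 0 ≤ |z| * (1 / (2 * √s) / (√s) ^ 2) := by positivity
    linarith
  have hle1 : (∫ s in (1:ℝ)..t, (√s)⁻¹ * Real.exp (-(a * s - z) ^ 2 / (b * s)))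
      ≤ ∫ s in (1:ℝ)..t, 2 / |a| * (((fun w : ℝ => Real.exp (-b⁻¹ * w ^ 2)) ∘ φ) s * φ' s) := by
    apply intervalIntegral.integral_mono_on ht
    · apply ContinuousOn.intervalIntegrable
      intro s hs
      have h00 := (hpos s hs)
      have h0 := (Real.sqrt_pos.mpr h00).ne'
      have h2 : b * s ≠ 0 := by positivity
      apply ContinuousAt.continuousWithinAt
      fun_prop (disch := assumption)
    · apply ContinuousOn.intervalIntegrable
      apply ContinuousOn.mul continuousOn_const
      apply ContinuousOn.mul _ hcont'
      exact Continuous.comp_continuousOn (by fun_prop) hφcont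
    · intro s hs
      have hs0 : 0 < s := lt_of_lt_of_le one_pos hs.1
      have h0 := Real.sqrt_pos.mpr hs0
      have h1 : Real.exp (-(a * s - z) ^ 2 / (b * s)) ≤ Real.exp (-b⁻¹ * (φ s) ^ 2) := by
        apply Real.exp_le_exp.mpr
        have e : φ s ^ 2 = (|a| * s - |z|) ^ 2 / s := by
          have hsq : √s ^ 2 = s := Real.sq_sqrt hs0.le
          have : φ s = (|a| * √s ^ 2 - |z|) / √s := by
            simp only [hφ]; field_simp
          rw [this, div_pow, hsq]
        rw [e]
        have key : (|a| * s - |z|) ^ 2 ≤ (a * s - z) ^ 2 := by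
          have : a * s * z ≤ |a| * s * |z| := by
            calc a * s * z ≤ |a * s * z| := le_abs_self _
              _ = _ := by rw [abs_mul, abs_mul, abs_of_pos hs0]
          have e3 : (|a| * s - |z|) ^ 2 = a ^ 2 * s ^ 2 - 2 * (|a| * s * |z|) + z ^ 2 := by
            rw [← sq_abs a, ← sq_abs z]; ring
          rw [e3]
          nlinarith
        have e1 : -(a * s - z) ^ 2 / (b * s) = -((a * s - z) ^ 2 / (b * s)) := by ring
        have e2 : -b⁻¹ * ((|a| * s - |z|) ^ 2 / s) = -((|a| * s - |z|) ^ 2 / (b * s)) := by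
          field_simp
        rw [e1, e2]
        gcongr
      have h2 := hφ'nn s hs
      have h3 : (√s)⁻¹ ≤ 2 / |a| * φ' s := by
        calc (√s)⁻¹ = 2 / |a| * (|a| / 2 * (√s)⁻¹) := by field_simp
          _ ≤ _ := by gcongr
      calc _ ≤ (2 / |a| * φ' s) * Real.exp (-b⁻¹ * (φ s) ^ 2) := by
            apply mul_le_mul h3 h1 (Real.exp_pos _).le
            exact le_trans (by positivity) h3
        _ = _ := by simp only [Function.comp]; ring
  refine hle1.trans ?_
  rw [intervalIntegral.integral_const_mul, hsub]
  gcongr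
  have hmono : φ 1 ≤ φ t := by
    simp only [hφ]
    have h1 : √1 ≤ √t := Real.sqrt_le_sqrt ht
    rw [Real.sqrt_one] at *
    have h2 : (√t)⁻¹ ≤ 1⁻¹ := inv_anti₀ one_pos h1
    nlinarith
  rw [intervalIntegral.integral_of_le hmono]
  refine (setIntegral_le_integral hint (Filter.Eventually.of_forall fun w => (Real.exp_pos _).le)).trans ?_
  rw [integral_gaussian, div_inv_eq_mul]

/-- Strichartz-type estimate: the time integral of the weighted moving Gaussian
s^{-1-υ}e^{-(as-z)²/(bs)} is bounded in L²(dz), uniformly in t ≥ 1. -/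
theorem stmt_16 (a b υ : ℝ) (ha : a ≠ 0) (hb : 0 < b) (hυ : 0 < υ) :
    ∃ C > (0:ℝ), ∀ t ≥ (1:ℝ),
      (∫ z : ℝ, (∫ s in (1:ℝ)..t,
        s ^ (-1 - υ) * Real.exp (-(a * s - z) ^ 2 / (b * s))) ^ 2) ≤ C ^ 2 := by
  have hα : 0 < |a| := abs_pos.mpr ha
  have hpi := Real.pi_pos
  set K : ℝ := 2 / |a| * √(Real.pi * b) with hK
  have hKpos : 0 < K := by positivity
  set I : ℝ := ∫ s in Set.Ioi (1:ℝ), √(Real.pi * b) * s ^ (-1 - 2 * υ) with hI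
  have hIint : IntegrableOn (fun s : ℝ => √(Real.pi * b) * s ^ (-1 - 2 * υ)) (Set.Ioi 1) :=
    (integrableOn_Ioi_rpow_of_lt (by linarith) one_pos).const_mul _
  have hI0 : 0 ≤ I := by
    apply setIntegral_nonneg measurableSet_Ioi
    intro s hs
    have : (0:ℝ) < s := lt_trans one_pos hs
    positivity
  have hM : 0 ≤ K * I := by positivity
  refine ⟨K * I + 1, by positivity, ?_⟩
  intro t ht
  set E : ℝ → ℝ → ℝ := fun s z => Real.exp (-(a * s - z) ^ 2 / (b * s)) with hE
  set h : ℝ → ℝ → ℝ := fun s z => (s ^ (-1 - 2 * υ) * (√s)⁻¹) * E s z with hh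
  have hpos : ∀ s ∈ Set.uIcc 1 t, 0 < s := by
    intro s hs
    rw [Set.uIcc_of_le ht] at hs
    linarith [hs.1]
  -- Gaussian in z
  have hgi : ∀ s : ℝ, 0 < s → Integrable (fun z => E s z) ∧ ∫ z, E s z = √(Real.pi * b) * √s := by
    intro s hs
    have e : (fun z => E s z) = fun z => (fun w : ℝ => Real.exp (-(b * s)⁻¹ * w ^ 2)) (z - a * s) := by
      funext z
      simp only [hE]
      congr 1
      field_simp
      ring
    have hi : Integrable (fun w : ℝ => Real.exp (-(b * s)⁻¹ * w ^ 2)) :=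
      integrable_exp_neg_mul_sq (by positivity)
    refine ⟨by rw [e]; exact hi.comp_sub_right (a * s), ?_⟩
    rw [e, integral_sub_right_eq_self (fun w : ℝ => Real.exp (-(b * s)⁻¹ * w ^ 2)) (a * s), integral_gaussian,
      div_inv_eq_mul, ← mul_assoc, Real.sqrt_mul (by positivity)]
  have hzi : ∀ s : ℝ, 0 < s → ∫ z, h s z = √(Real.pi * b) * s ^ (-1 - 2 * υ) := by
    intro s hs
    simp only [hh]
    rw [integral_const_mul, (hgi s hs).2]
    have := Real.sqrt_pos.mpr hs
    field_simp
  have hhnn : ∀ s : ℝ, 0 < s → ∀ z, 0 ≤ h s z := by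
    intro s hs z
    simp only [hh, hE]
    positivity
  have hprod : Integrable (Function.uncurry h) ((volume.restrict (Set.Ioc 1 t)).prod volume) := by
    rw [integrable_prod_iff]
    · constructor
      · refine (ae_restrict_iff' measurableSet_Ioc).mpr (Filter.Eventually.of_forall fun s hs => ?_)
        exact (hgi s (lt_trans one_pos hs.1)).1.const_mul (s ^ (-1 - 2 * υ) * (√s)⁻¹)
      · have : IntegrableOn (fun s : ℝ => √(Real.pi * b) * s ^ (-1 - 2 * υ)) (Set.Ioc 1 t) :=
          hIint.mono_set Set.Ioc_subset_Ioi_self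
        refine this.congr_fun (fun s hs => ?_) measurableSet_Ioc
        have hs0 : (0:ℝ) < s := lt_trans one_pos hs.1
        simp only [Function.uncurry]
        rw [← hzi s hs0]
        congr 1
        funext z
        rw [Real.norm_of_nonneg (hhnn s hs0 z)]
    · apply Measurable.aestronglyMeasurable
      simp only [hh, hE, Function.uncurry_def]
      fun_prop
  have hpt : ∀ z, (∫ s in (1:ℝ)..t, s ^ (-1 - υ) * E s z) ^ 2 ≤ K * ∫ s in (1:ℝ)..t, h s z := by
    intro z
    set F := ∫ s in (1:ℝ)..t, s ^ (-1 - υ) * E s z with hF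
    have hG := aux_G a b ha hb z t ht
    rw [← hK] at hG
    have ci : ∀ p : ℝ, IntervalIntegrable (fun s => s ^ p * E s z) volume 1 t := by
      intro p
      apply ContinuousOn.intervalIntegrable
      intro s hs
      have h00 := (hpos s hs)
      have h2 : b * s ≠ 0 := by positivity
      apply ContinuousAt.continuousWithinAt
      apply ContinuousAt.mul (Real.continuousAt_rpow_const _ _ (Or.inl h00.ne'))
      simp only [hE]
      fun_prop (disch := assumption)
    have c1 : IntervalIntegrable (fun s => (√s)⁻¹ * E s z) volume 1 t := by
      apply (ci (-(1/2))).congr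
      intro s hs
      have : 0 < s := hpos s (Set.uIoc_subset_uIcc hs)
      simp only
      rw [Real.rpow_neg this.le, Real.sqrt_eq_rpow]
    have c2 : IntervalIntegrable (fun s => h s z) volume 1 t := by
      apply (ci (-1 - 2 * υ - 1/2)).congr
      intro s hs
      have : 0 < s := hpos s (Set.uIoc_subset_uIcc hs)
      simp only [hh]
      rw [Real.sqrt_eq_rpow, ← Real.rpow_neg this.le, ← Real.rpow_add this]
      congr 1
    have key : ∫ s in (1:ℝ)..t, (2 * K * F) * (s ^ (-1 - υ) * E s z)
        ≤ ∫ s in (1:ℝ)..t, (K ^ 2 * h s z + F ^ 2 * ((√s)⁻¹ * E s z)) := by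
      apply intervalIntegral.integral_mono_on ht ((ci _).const_mul _)
        ((c2.const_mul _).add (c1.const_mul _))
      intro s hs
      have hs0 : 0 < s := lt_of_lt_of_le one_pos hs.1
      have e1 : s ^ (-1 - υ) = s ^ (-(1/2) - υ) * (√s)⁻¹ := by
        rw [Real.sqrt_eq_rpow, ← Real.rpow_neg hs0.le, ← Real.rpow_add hs0]
        congr 1; ring
      have e2 : s ^ (-1 - 2 * υ) = (s ^ (-(1/2) - υ)) ^ 2 := by
        rw [← Real.rpow_natCast, ← Real.rpow_mul hs0.le]
        congr 1; push_cast; ring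
      simp only [hh]
      rw [e1, e2]
      have hp : 0 ≤ (√s)⁻¹ * E s z * (K * s ^ (-(1/2) - υ) - F) ^ 2 := by
        simp only [hE]; positivity
      nlinarith [hp]
    rw [intervalIntegral.integral_const_mul, intervalIntegral.integral_add (c2.const_mul _) (c1.const_mul _),
      intervalIntegral.integral_const_mul, intervalIntegral.integral_const_mul, ← hF] at key
    have h3 := mul_le_mul_of_nonneg_left hG (sq_nonneg F)
    have h4 : K * F ^ 2 ≤ K * (K * ∫ s in (1:ℝ)..t, h s z) := by
      simp only [hE] at key h3 ⊢
      linarith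
    exact le_of_mul_le_mul_left h4 hKpos
  have hHint : Integrable (fun z => ∫ s in (1:ℝ)..t, h s z) := by
    simp only [intervalIntegral.integral_of_le ht]
    exact hprod.integral_prod_right
  calc _ ≤ ∫ z, K * ∫ s in (1:ℝ)..t, h s z :=
        integral_mono_of_nonneg (Filter.Eventually.of_forall fun z => sq_nonneg _)
          (hHint.const_mul K) (Filter.Eventually.of_forall hpt)
    _ = K * ∫ s in Set.Ioc 1 t, ∫ z, h s z := by
        rw [integral_const_mul]
        simp only [intervalIntegral.integral_of_le ht]
        rw [integral_integral_swap hprod]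
    _ = K * ∫ s in Set.Ioc 1 t, √(Real.pi * b) * s ^ (-1 - 2 * υ) := by
        congr 1
        exact setIntegral_congr_fun measurableSet_Ioc fun s hs => hzi s (lt_trans one_pos hs.1)
    _ ≤ K * I := by
        apply mul_le_mul_of_nonneg_left _ hKpos.le
        apply setIntegral_mono_set hIint
        · refine (ae_restrict_iff' measurableSet_Ioi).mpr (Filter.Eventually.of_forall fun s hs => ?_)
          have : (0:ℝ) < s := lt_trans one_pos hs
          simp only [Pi.zero_apply]
          positivity
        · exact Set.Ioc_subset_Ioi_self.eventuallyLE
    _ ≤ _ := by nlinarith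
end

section
/- Let a∈ℝ with a≠0 and b>0. Then there exists C>0 such that for every z∈ℝ: ∫₁^∞ s^{−1/2} e^{−(z−as)²/(bs)} ds ≤ C. -/
open MeasureTheory

/-- Transversality estimate: the time integral over [1,∞) of the moving Gaussian
s^{-1/2}e^{-(z-as)²/(bs)} along any vertical line is bounded uniformly in z. -/
theorem stmt_17 (a b : ℝ) (ha : a ≠ 0) (hb : 0 < b) :
    ∃ C > (0:ℝ), ∀ z : ℝ,
      (∫ s in Set.Ici (1:ℝ),
        s ^ (-(1:ℝ)/2) * Real.exp (-(z - a * s) ^ 2 / (b * s))) ≤ C := by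
  have hk : 0 < a ^ 2 / b := by positivity
  refine ⟨2 * Real.sqrt (Real.pi / (a ^ 2 / b)), by positivity, fun z => ?_⟩
  set k := a ^ 2 / b with hkdef
  set r := Real.sqrt (z / a) with hr
  have hr0 : 0 ≤ r := Real.sqrt_nonneg _
  set G : ℝ → ℝ := fun y => 2 * Real.exp (-k * (y - r) ^ 2) with hG
  have hGi : Integrable G :=
    ((integrable_exp_neg_mul_sq hk).comp_sub_right r).const_mul 2
  have hGint : ∫ y, G y = 2 * Real.sqrt (Real.pi / k) := by
    rw [hG, integral_const_mul, integral_sub_right_eq_self (fun y => Real.exp (-k * y ^ 2)) r,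
      integral_gaussian]
  have hp : (1 / 2 : ℝ) ≠ 0 := by norm_num
  have hcv := integral_comp_rpow_Ioi G hp
  have hci := (integrableOn_Ioi_comp_rpow_iff G hp).2 hGi.integrableOn
  set H : ℝ → ℝ := fun x => (|(1 / 2 : ℝ)| * x ^ ((1 / 2 : ℝ) - 1)) • G (x ^ (1 / 2 : ℝ)) with hH
  have hci' : IntegrableOn H (Set.Ioi 0) := hci
  have hsub : Set.Ici (1:ℝ) ⊆ Set.Ioi 0 := fun x hx => Set.mem_Ioi.2 (lt_of_lt_of_le one_pos (Set.mem_Ici.1 hx))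
  have hG0 : ∀ y, 0 ≤ G y := fun y => by simp only [hG]; positivity
  calc _ ≤ ∫ s in Set.Ici (1:ℝ), H s := by
        refine integral_mono_of_nonneg ?_ (hci'.mono_set hsub) ?_
        · filter_upwards [ae_restrict_mem measurableSet_Ici] with s hs
          have : 0 < s := hsub hs
          simp only [Pi.zero_apply]
          positivity
        · filter_upwards [ae_restrict_mem measurableSet_Ici] with s hs
          have hs0 : 0 < s := hsub hs
          have e1 : H s = s ^ (-(1:ℝ)/2) * Real.exp (-k * (Real.sqrt s - r) ^ 2) := by
            simp only [hH, hG, smul_eq_mul]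
            rw [← Real.sqrt_eq_rpow, abs_of_pos (by norm_num : (0:ℝ) < 1/2),
              show (1/2 : ℝ) - 1 = -1/2 by norm_num]
            ring
          simp only [e1]
          gcongr
          obtain ⟨u, hu, rfl⟩ : ∃ u : ℝ, 0 < u ∧ s = u ^ 2 :=
            ⟨Real.sqrt s, Real.sqrt_pos.2 hs0, (Real.sq_sqrt hs0.le).symm⟩
          rw [Real.sqrt_sq hu.le]
          have hz : z = a * (z / a) := by field_simp
          set w := z / a with hw
          have key : (u * (u - r)) ^ 2 ≤ (w - u ^ 2) ^ 2 := by
            rcases le_total 0 w with h | h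
            · have : w = r ^ 2 := (Real.sq_sqrt h).symm
              rw [this]
              have : (r ^ 2 - u ^ 2) ^ 2 - (u * (u - r)) ^ 2
                  = (u - r) ^ 2 * (r * (2 * u + r)) := by ring
              have : 0 ≤ (u - r) ^ 2 * (r * (2 * u + r)) := by positivity
              linarith
            · have : r = 0 := Real.sqrt_eq_zero_of_nonpos h
              rw [this]
              nlinarith [sq_nonneg w, mul_nonneg (neg_nonneg.2 h) (sq_nonneg u)]
          rw [hz, hkdef, div_le_iff₀ (by positivity)]
          have : -(a ^ 2 / b) * (u - r) ^ 2 * (b * u ^ 2) = -(a ^ 2 * (u * (u - r)) ^ 2) := by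
            field_simp
          rw [this]
          nlinarith [mul_le_mul_of_nonneg_left key (sq_nonneg a)]
    _ ≤ ∫ s in Set.Ioi (0:ℝ), H s := by
        refine setIntegral_mono_set hci' ?_ hsub.eventuallyLE
        filter_upwards [ae_restrict_mem measurableSet_Ioi] with s hs
        have hs0 : 0 < s := hs
        have := hG0 (s ^ (1 / 2 : ℝ))
        simp only [hH, Pi.zero_apply, smul_eq_mul]
        positivity
    _ = ∫ y in Set.Ioi (0:ℝ), G y := hcv
    _ ≤ ∫ y, G y := setIntegral_le_integral hGi (Filter.Eventually.of_forall hG0)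
    _ = _ := hGint
end

section
/- Let a>0, b>0 and υ>0. Then there exists C>0 such that for all t≥1: ∫₀^∞ ( ∫₁^t 1_{2|z−as|<b√s} · s^{−1−υ} ds )² dz ≤ C, where 1_{2|z−as|<b√s} denotes the indicator of the set of s with 2|z−as|<b√s. -/
open MeasureTheory

lemma strip_inner (a b υ : ℝ) (ha : 0 < a) (hb : 0 < b) (hυ : 0 < υ) :
    ∃ A > (0:ℝ), ∀ t ≥ (1:ℝ), ∀ z > (0:ℝ),
      0 ≤ (∫ s in (1:ℝ)..t,
          if 2 * |z - a * s| < b * Real.sqrt s then s ^ (-1 - υ) else 0) ∧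
      (∫ s in (1:ℝ)..t,
          if 2 * |z - a * s| < b * Real.sqrt s then s ^ (-1 - υ) else 0)
        ≤ A * (Real.sqrt (z + 1) * (z + 1) ^ (-1 - υ)) := by
  obtain ⟨M, hMdef⟩ : ∃ M, M = 2 / a + b ^ 2 / (4 * a ^ 2) := ⟨_, rfl⟩
  obtain ⟨c, hcdef⟩ : ∃ c, c = (1 + a + b / 2)⁻¹ := ⟨_, rfl⟩
  have hM : 0 < M := by rw [hMdef]; positivity
  have hc : 0 < c := by rw [hcdef]; positivity
  refine ⟨(b / a * Real.sqrt M) * c ^ (-1 - υ), by positivity, ?_⟩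
  intro t ht z hz
  rw [intervalIntegral.integral_of_le ht]
  have hnn : ∀ s ∈ Set.Ioc (1:ℝ) t,
      0 ≤ (if 2 * |z - a * s| < b * Real.sqrt s then s ^ (-1 - υ) else (0:ℝ)) := by
    intro s hs
    have : 0 < s := by linarith [hs.1]
    split_ifs
    · positivity
    · exact le_rfl
  refine ⟨setIntegral_nonneg measurableSet_Ioc hnn, ?_⟩
  obtain ⟨R, hR⟩ : ∃ R, R = b / (2 * a) * (Real.sqrt M * Real.sqrt (z + 1)) := ⟨_, rfl⟩
  have hRpos : 0 ≤ R := by rw [hR]; positivity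
  obtain ⟨B, hB⟩ : ∃ B, B = (c * (z + 1)) ^ (-1 - υ) := ⟨_, rfl⟩
  have hBpos : 0 ≤ B := by rw [hB]; positivity
  have key : ∀ s ∈ Set.Ioc (1:ℝ) t,
      (if 2 * |z - a * s| < b * Real.sqrt s then s ^ (-1 - υ) else (0:ℝ)) ≤
        (Set.Icc (z / a - R) (z / a + R)).indicator (fun _ => B) s := by
    intro s hs
    have hs1 : 1 < s := hs.1
    have hs0 : 0 < s := by linarith
    split_ifs with h
    · have hsq : Real.sqrt s ^ 2 = s := Real.sq_sqrt hs0.le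
      have hq1 : 1 ≤ Real.sqrt s := by
        rw [Real.one_le_sqrt]; exact hs1.le
      have hqs : Real.sqrt s ≤ s := by nlinarith
      have h1 := neg_abs_le (z - a * s)
      have h2 := le_abs_self (z - a * s)
      have hlow : c * (z + 1) ≤ s := by
        rw [hcdef, inv_mul_le_iff₀ (by positivity)]
        nlinarith
      have hup : s ≤ M * (z + 1) := by
        have e1 : a * s ≤ z + b / 2 * Real.sqrt s := by linarith
        have e2 : b / 2 * Real.sqrt s ≤ a * s / 2 + b ^ 2 / (8 * a) := by
          have : a * s / 2 + b ^ 2 / (8 * a) - b / 2 * Real.sqrt s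
              = (2 * a * Real.sqrt s - b) ^ 2 / (8 * a) := by
            field_simp
            nlinarith
          have h3 : 0 ≤ (2 * a * Real.sqrt s - b) ^ 2 / (8 * a) := by positivity
          linarith
        have e3 : s ≤ 2 / a * (z + b ^ 2 / (8 * a)) := by
          rw [div_mul_eq_mul_div, le_div_iff₀ ha]
          linarith
        have e4 : M * (z + 1) - 2 / a * (z + b ^ 2 / (8 * a))
            = 2 / a + b ^ 2 / (4 * a ^ 2) * z := by
          rw [hMdef]; field_simp; ring
        have : 0 ≤ 2 / a + b ^ 2 / (4 * a ^ 2) * z := by positivity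
        linarith
      have hsR : Real.sqrt s ≤ Real.sqrt M * Real.sqrt (z + 1) := by
        rw [← Real.sqrt_mul hM.le]; exact Real.sqrt_le_sqrt hup
      have haR : a * R = b / 2 * (Real.sqrt M * Real.sqrt (z + 1)) := by
        rw [hR]; field_simp
      have hbs := mul_le_mul_of_nonneg_left hsR hb.le
      have hza : a * (z / a) = z := by field_simp
      have hmem : s ∈ Set.Icc (z / a - R) (z / a + R) := by
        constructor
        · apply le_of_mul_le_mul_left _ ha
          rw [mul_sub, hza, haR]; linarith
        · apply le_of_mul_le_mul_left _ ha
          rw [mul_add, hza, haR]; linarith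
      rw [Set.indicator_of_mem hmem, hB]
      exact Real.rpow_le_rpow_of_nonpos (by positivity) hlow (by linarith)
    · exact Set.indicator_nonneg (fun _ _ => hBpos) s
  have hint : Integrable ((Set.Icc (z / a - R) (z / a + R)).indicator (fun _ => B)) volume := by
    rw [integrable_indicator_iff measurableSet_Icc]
    exact integrableOn_const (by simp)
  calc _ ≤ ∫ s in Set.Ioc (1:ℝ) t, (Set.Icc (z / a - R) (z / a + R)).indicator (fun _ => B) s := by
        apply integral_mono_of_nonneg
        · exact (ae_restrict_iff' measurableSet_Ioc).2 (Filter.Eventually.of_forall hnn)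
        · exact hint.integrableOn
        · exact (ae_restrict_iff' measurableSet_Ioc).2 (Filter.Eventually.of_forall key)
    _ ≤ ∫ s, (Set.Icc (z / a - R) (z / a + R)).indicator (fun _ => B) s :=
        setIntegral_le_integral hint
          (Filter.Eventually.of_forall fun s => Set.indicator_nonneg (fun _ _ => hBpos) s)
    _ = 2 * R * B := by
        rw [integral_indicator measurableSet_Icc, setIntegral_const, Real.volume_real_Icc_of_le
          (by linarith), smul_eq_mul]
        ring
    _ = _ := by
        rw [hB, hR, Real.mul_rpow hc.le (by linarith)]
        field_simp

/-- Characteristic-strip estimate: the L²(dz)-norm on (0,∞) of the time integral of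
s^{-1-υ} over the strip {2|z-as| < b√s} is bounded uniformly in t ≥ 1. -/
theorem stmt_18 (a b υ : ℝ) (ha : 0 < a) (hb : 0 < b) (hυ : 0 < υ) :
    ∃ C > (0:ℝ), ∀ t ≥ (1:ℝ),
      (∫ z in Set.Ioi (0:ℝ),
        (∫ s in (1:ℝ)..t,
          if 2 * |z - a * s| < b * Real.sqrt s then s ^ (-1 - υ) else 0) ^ 2) ≤ C := by
  obtain ⟨A, hA, h⟩ := strip_inner a b υ ha hb hυ
  have hint : IntegrableOn (fun z : ℝ => A ^ 2 * (z + 1) ^ (-1 - 2 * υ)) (Set.Ioi 0) :=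
    (integrableOn_add_rpow_Ioi_of_lt (by linarith) (by norm_num)).const_mul _
  have h0 : 0 ≤ ∫ z in Set.Ioi (0:ℝ), A ^ 2 * (z + 1) ^ (-1 - 2 * υ) := by
    apply setIntegral_nonneg measurableSet_Ioi
    intro z hz
    have : (0:ℝ) < z := hz
    positivity
  refine ⟨(∫ z in Set.Ioi (0:ℝ), A ^ 2 * (z + 1) ^ (-1 - 2 * υ)) + 1, by linarith, ?_⟩
  intro t ht
  refine le_trans (integral_mono_of_nonneg ?_ hint ?_) (le_add_of_nonneg_right zero_le_one)
  · exact Filter.Eventually.of_forall fun z => sq_nonneg _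
  · refine (ae_restrict_iff' measurableSet_Ioi).2 (Filter.Eventually.of_forall ?_)
    intro z hz
    have hz' : (0:ℝ) < z := hz
    obtain ⟨h1, h2⟩ := h t ht z hz
    refine (pow_le_pow_left₀ h1 h2 2).trans (le_of_eq ?_)
    have hw : 0 < z + 1 := by linarith
    rw [mul_pow, mul_pow, Real.sq_sqrt hw.le, ← Real.rpow_natCast ((z + 1) ^ (-1 - υ)) 2,
      ← Real.rpow_mul hw.le]
    congr 1
    nth_rewrite 1 [← Real.rpow_one (z + 1)]
    rw [← Real.rpow_add hw]
    congr 1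
    push_cast
    ring
end

section
/- Let c₁>0 and c₂>0. Then there exists C>0 such that for every t≥1 and every ξ∈ℝ with t/(2c₁) ≤ ξ ≤ 2t/c₁: |(4πc₂·(t/c₁))^{−1/2}·e^{−c₁(t−c₁ξ)²/(4c₂t)} − (4πc₂ξ)^{−1/2}·e^{−(t−c₁ξ)²/(4c₂ξ)}| ≤ C·t⁻¹·e^{−c₁(t−c₁ξ)²/(16c₂t)}. -/
lemma exp_diff_aux (a b L : ℝ) (ha : L ≤ a) (hab : a ≤ b) :
    |Real.exp (-a) - Real.exp (-b)| ≤ |a - b| * Real.exp (-L) := by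
  have h1 : Real.exp (-b) ≤ Real.exp (-a) := Real.exp_le_exp.2 (by linarith)
  rw [abs_of_nonneg (by linarith), abs_of_nonpos (by linarith)]
  have h2 : Real.exp (-b) = Real.exp (-a) * Real.exp (a - b) := by
    rw [← Real.exp_add]; congr 1; ring
  have h3 := Real.add_one_le_exp (a - b)
  have h4 : Real.exp (-a) ≤ Real.exp (-L) := Real.exp_le_exp.2 (by linarith)
  have h5 := Real.exp_pos (-a)
  rw [h2]
  calc Real.exp (-a) - Real.exp (-a) * Real.exp (a - b)
      = (1 - Real.exp (a - b)) * Real.exp (-a) := by ring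
    _ ≤ (-(a - b)) * Real.exp (-a) := by gcongr; linarith
    _ ≤ _ := by
      apply mul_le_mul_of_nonneg_left h4; linarith

lemma exp_diff (a b L : ℝ) (ha : L ≤ a) (hb : L ≤ b) :
    |Real.exp (-a) - Real.exp (-b)| ≤ |a - b| * Real.exp (-L) := by
  rcases le_total a b with h | h
  · exact exp_diff_aux a b L ha h
  · rw [abs_sub_comm, abs_sub_comm a b]
    exact exp_diff_aux b a L hb h

lemma z_bound (z : ℝ) (hz : 0 ≤ z) :
    z * Real.exp (-z ^ 2) ≤ Real.exp (-(z ^ 2 / 4)) := by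
  have h1 := Real.add_one_le_exp (3 * z ^ 2 / 4)
  have h2 : z ≤ Real.exp (3 * z ^ 2 / 4) := by nlinarith [sq_nonneg (3 * z - 2)]
  calc z * Real.exp (-z ^ 2) ≤ Real.exp (3 * z ^ 2 / 4) * Real.exp (-z ^ 2) := by gcongr
    _ = _ := by rw [← Real.exp_add]; congr 1; ring

lemma z3_bound (z : ℝ) (hz : 0 ≤ z) :
    z ^ 3 * Real.exp (-(z ^ 2 / 2)) ≤ 16 * Real.exp (-(z ^ 2 / 4)) := by
  have h1 := Real.add_one_le_exp (z ^ 2 / 8)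
  have h2 : z ≤ 2 * Real.exp (z ^ 2 / 8) := by nlinarith [sq_nonneg (z - 2)]
  have h3 : z ^ 2 ≤ 8 * Real.exp (z ^ 2 / 8) := by linarith
  have h4 : z ^ 3 ≤ 16 * Real.exp (z ^ 2 / 4) := by
    calc z ^ 3 = z * z ^ 2 := by ring
      _ ≤ (2 * Real.exp (z ^ 2 / 8)) * (8 * Real.exp (z ^ 2 / 8)) := by gcongr
      _ = 16 * (Real.exp (z ^ 2 / 8) * Real.exp (z ^ 2 / 8)) := by ring
      _ = _ := by rw [← Real.exp_add]; congr 2; ring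
  calc z ^ 3 * Real.exp (-(z ^ 2 / 2))
      ≤ 16 * Real.exp (z ^ 2 / 4) * Real.exp (-(z ^ 2 / 2)) := by gcongr
    _ = _ := by rw [mul_assoc, ← Real.exp_add]; congr 2; ring

lemma core (m r q : ℝ) (hm : 0 < m) (hr : 0 < r) (hq : 0 < q)
    (hlo : r ^ 2 / 2 ≤ q ^ 2) (hhi : q ^ 2 ≤ 2 * r ^ 2) :
    |r⁻¹ * Real.exp (-(m ^ 2 * (r ^ 2 - q ^ 2) ^ 2 / r ^ 2)) -
      q⁻¹ * Real.exp (-(m ^ 2 * (r ^ 2 - q ^ 2) ^ 2 / q ^ 2))| ≤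
    66 / m * (r ^ 2)⁻¹ * Real.exp (-(m ^ 2 * (r ^ 2 - q ^ 2) ^ 2 / r ^ 2 / 4)) := by
  obtain ⟨z, hzdef⟩ : ∃ z, z = m * |r ^ 2 - q ^ 2| / r := ⟨_, rfl⟩
  have hz : 0 ≤ z := by rw [hzdef]; positivity
  have hd : |r ^ 2 - q ^ 2| = z * r / m := by rw [hzdef]; field_simp
  have hX : m ^ 2 * (r ^ 2 - q ^ 2) ^ 2 / r ^ 2 = z ^ 2 := by
    rw [hzdef, div_pow, mul_pow, sq_abs]
  obtain ⟨Y, hY⟩ : ∃ Y, Y = m ^ 2 * (r ^ 2 - q ^ 2) ^ 2 / q ^ 2 := ⟨_, rfl⟩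
  have hYz : Y = z ^ 2 * r ^ 2 / q ^ 2 := by rw [hY, ← hX]; field_simp
  have hYlo : z ^ 2 / 2 ≤ Y := by
    rw [hYz, div_le_div_iff₀ (by norm_num) (by positivity)]
    nlinarith [sq_nonneg z]
  have hXY : |z ^ 2 - Y| ≤ 2 * z ^ 3 / (m * r) := by
    have e : z ^ 2 - Y = z ^ 2 * (-(r ^ 2 - q ^ 2)) / q ^ 2 := by
      rw [hYz]; field_simp; ring
    rw [e, abs_div, abs_mul, abs_neg, hd, abs_of_nonneg (sq_nonneg z),
      abs_of_nonneg (sq_nonneg q)]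
    rw [div_le_div_iff₀ (by positivity) (by positivity)]
    have : z ^ 2 * (z * r / m) * (m * r) = z ^ 3 * r ^ 2 := by field_simp
    rw [this]
    have : 0 ≤ z ^ 3 := by positivity
    nlinarith
  have hrq : r ≤ 2 * q := by nlinarith
  have hqi : q⁻¹ ≤ 2 / r := by
    rw [inv_eq_one_div, div_le_div_iff₀ hq hr]; linarith
  have hinv : |r⁻¹ - q⁻¹| ≤ 2 * z / (m * r ^ 2) := by
    have e : r⁻¹ - q⁻¹ = -(r ^ 2 - q ^ 2) / (r * q * (r + q)) := by
      field_simp; ring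
    rw [e, abs_div, abs_neg, hd, abs_of_pos (by positivity : 0 < r * q * (r + q))]
    rw [div_le_div_iff₀ (by positivity) (by positivity)]
    have : z * r / m * (m * r ^ 2) = z * r * r ^ 2 := by field_simp
    rw [this]
    have h : r ^ 2 ≤ 2 * (q * (r + q)) := by nlinarith
    have := mul_le_mul_of_nonneg_left h (mul_nonneg hz hr.le)
    linarith
  rw [← hY, hX]
  have e1 := exp_diff (z ^ 2) Y (z ^ 2 / 2) (by nlinarith [sq_nonneg z]) hYlo
  have e2 := z_bound z hz
  have e3 := z3_bound z hz
  calc |r⁻¹ * Real.exp (-z ^ 2) - q⁻¹ * Real.exp (-Y)|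
      = |(r⁻¹ - q⁻¹) * Real.exp (-z ^ 2) + q⁻¹ * (Real.exp (-z ^ 2) - Real.exp (-Y))| := by
        congr 1; ring
    _ ≤ |r⁻¹ - q⁻¹| * Real.exp (-z ^ 2) + q⁻¹ * |Real.exp (-z ^ 2) - Real.exp (-Y)| := by
        refine (abs_add_le _ _).trans (le_of_eq ?_)
        rw [abs_mul, abs_mul, Real.abs_exp, abs_of_pos (inv_pos.2 hq)]
    _ ≤ 2 * z / (m * r ^ 2) * Real.exp (-z ^ 2) +
        2 / r * ((2 * z ^ 3 / (m * r)) * Real.exp (-(z ^ 2 / 2))) := by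
        gcongr
        exact e1.trans (by gcongr)
    _ = 2 / (m * r ^ 2) * (z * Real.exp (-z ^ 2)) +
        4 / (m * r ^ 2) * (z ^ 3 * Real.exp (-(z ^ 2 / 2))) := by
        field_simp; ring
    _ ≤ 2 / (m * r ^ 2) * Real.exp (-(z ^ 2 / 4)) +
        4 / (m * r ^ 2) * (16 * Real.exp (-(z ^ 2 / 4))) := by gcongr
    _ = _ := by field_simp; ring

lemma rpow_aux (B s : ℝ) (hB : 0 < B) (hs : 0 < s) :
    (B * s) ^ (-(1:ℝ)/2) = B ^ (-(1:ℝ)/2) * (√s)⁻¹ := by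
  rw [Real.mul_rpow hB.le hs.le, Real.sqrt_eq_rpow, ← Real.rpow_neg hs.le]
  norm_num

/-- Error estimate comparing the Gaussian heat-kernel profile evaluated at the two
comparable arguments t/c₁ and ξ: the difference decays one power of t faster, with a
slightly widened Gaussian envelope. -/
theorem stmt_19 (c₁ c₂ : ℝ) (h1 : 0 < c₁) (h2 : 0 < c₂) :
    ∃ C > (0:ℝ), ∀ t ≥ (1:ℝ), ∀ ξ : ℝ, t / (2 * c₁) ≤ ξ → ξ ≤ 2 * t / c₁ →
      |(4 * Real.pi * c₂ * (t / c₁)) ^ (-(1:ℝ)/2) *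
          Real.exp (-c₁ * (t - c₁ * ξ) ^ 2 / (4 * c₂ * t)) -
        (4 * Real.pi * c₂ * ξ) ^ (-(1:ℝ)/2) *
          Real.exp (-(t - c₁ * ξ) ^ 2 / (4 * c₂ * ξ))| ≤
      C * t⁻¹ * Real.exp (-c₁ * (t - c₁ * ξ) ^ 2 / (16 * c₂ * t)) := by
  obtain ⟨A, hA⟩ : ∃ A, A = (4 * Real.pi * c₂ / c₁) ^ (-(1:ℝ)/2) := ⟨_, rfl⟩
  have hpi := Real.pi_pos
  have hB : 0 < 4 * Real.pi * c₂ / c₁ := by positivity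
  have hApos : 0 < A := by rw [hA]; exact Real.rpow_pos_of_pos hB _
  obtain ⟨m, hmdef⟩ : ∃ m, m = √(c₁ / (4 * c₂)) := ⟨_, rfl⟩
  have hm : 0 < m := by rw [hmdef]; exact Real.sqrt_pos.2 (by positivity)
  have hm2 : m ^ 2 = c₁ / (4 * c₂) := by rw [hmdef]; exact Real.sq_sqrt (by positivity)
  refine ⟨A * (66 / m), by positivity, ?_⟩
  intro t ht ξ hlo hhi
  have ht0 : 0 < t := by linarith
  have hξ : 0 < ξ := lt_of_lt_of_le (by positivity) hlo
  rw [div_le_iff₀ (by positivity)] at hlo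
  rw [le_div_iff₀ h1] at hhi
  have hs : 0 < c₁ * ξ := by positivity
  have hr2 : √t ^ 2 = t := Real.sq_sqrt ht0.le
  have hq2 : √(c₁ * ξ) ^ 2 = c₁ * ξ := Real.sq_sqrt hs.le
  have key := core m √t √(c₁ * ξ) hm (Real.sqrt_pos.2 ht0) (Real.sqrt_pos.2 hs)
    (by rw [hr2, hq2]; linarith) (by rw [hr2, hq2]; linarith)
  rw [hr2, hq2, hm2] at key
  have p1 : 4 * Real.pi * c₂ * (t / c₁) = 4 * Real.pi * c₂ / c₁ * t := by ring
  have p2 : 4 * Real.pi * c₂ * ξ = 4 * Real.pi * c₂ / c₁ * (c₁ * ξ) := by field_simp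
  have x1 : -c₁ * (t - c₁ * ξ) ^ 2 / (4 * c₂ * t) =
      -(c₁ / (4 * c₂) * (t - c₁ * ξ) ^ 2 / t) := by field_simp
  have x2 : -(t - c₁ * ξ) ^ 2 / (4 * c₂ * ξ) =
      -(c₁ / (4 * c₂) * (t - c₁ * ξ) ^ 2 / (c₁ * ξ)) := by field_simp
  have x3 : -c₁ * (t - c₁ * ξ) ^ 2 / (16 * c₂ * t) =
      -(c₁ / (4 * c₂) * (t - c₁ * ξ) ^ 2 / t / 4) := by field_simp; norm_num
  rw [p1, p2, rpow_aux _ _ hB ht0, rpow_aux _ _ hB hs, ← hA, x1, x2, x3,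
    mul_assoc A, mul_assoc A, ← mul_sub, abs_mul, abs_of_pos hApos, mul_assoc A, mul_assoc A]
  exact mul_le_mul_of_nonneg_left key hApos.le
end
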